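/- Suppose r_X + r_Y ≠ 0. Then the upper tail probability F̄(x) = P(S_n > x) admits the asymptotic expansion, as x → ∞: F̄(x) ∼ ((1+ρ)C_n/(2√(2π))) ((1+ρ)/(|r_X+r_Y|√n))^{(n−1)/2} exp((n/8)((1+ρ)/(1−ρ))(r_X−r_Y)²) · (x/s)^{(n−3)/4} exp((|r_X+r_Y|/(1+ρ))√(nx/s) − x/(s(1+ρ))) · Σ_{p=0}^∞ γ_p(r_X,r_Y,ρ,n) s^{p/2} x^{−p/2}, where γ_0 = 1 and, for p ≥ 1, γ_p(r_X,r_Y,ρ,n) = Σ_{i,j,k,ℓ ≥ 0, i+2j+k+ℓ = p} (−1)^{j+i} c_ℓ(r_X,r_Y,ρ,n) binom((n−1)/2−ℓ, k) binom((n−3)/2−ℓ−k−2j, i) ((ℓ+k)/2−(n−3)/4)_j (1+ρ)^j (|r_X+r_Y|√n/2)^{k+i}; that is, for every integer N ≥ 0, F̄(x) equals the prefactor times (Σ_{p=0}^N γ_p s^{p/2} x^{−p/2} + o(x^{−N/2})) as x → ∞. -/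

import Mathlib

noncomputable section
open MeasureTheory Filter Asymptotics Topology Finset


/-- Ascending factorial (Pochhammer symbol) `(v)_j = v (v+1) ⋯ (v+j−1)`. -/
def poch (v : ℝ) (j : ℕ) : ℝ := ∏ t ∈ Finset.range j, (v + t)

/-- Generalized binomial coefficient `binom(α, k) = α (α−1) ⋯ (α−k+1)/k!`. -/
def genBinom (α : ℝ) (k : ℕ) : ℝ := (∏ t ∈ Finset.range k, (α - t)) / (Nat.factorial k)

/-- Confluent hypergeometric function of the first kind `M(a,b,x)`. -/
def hypM (a b x : ℝ) : ℝ := ∑' j : ℕ, poch a j / poch b j * x ^ j / (Nat.factorial j)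

/-- `compS q m` is the sum over compositions `r` of `q` into `m` positive parts of
`∏ binom(1/2, r_t)`. -/
def compS (q m : ℕ) : ℝ :=
  if m ≤ q then
    ∑ r ∈ Finset.Nat.antidiagonalTuple m (q - m), ∏ t, genBinom (1 / 2) (1 + r t)
  else 0

/-- `puiseuxG a b i j` is the coefficient of `u^i y^(j/2)` in the Puiseux series expansion of
`(1+uy)^a exp(b y^(−1/2) (√(1+uy) − 1))` about `y = 0`. -/
def puiseuxG (a b : ℝ) (i j : ℕ) : ℝ :=
  if j ≤ 2 * i then
    ∑ p ∈ Finset.range (j - i + 1),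
      genBinom a p * b ^ (2 * i - j) / (Nat.factorial (2 * i - j)) * compS (i - p) (2 * i - j)
  else 0

/-- The coefficient `h_{j,ℓ}(r_X, r_Y, ρ, n)`. -/
def hCoef (rX rY ρ : ℝ) (n : ℕ) (j ℓ : ℕ) : ℝ :=
  poch ((3 - (n : ℝ)) / 2) (ℓ - j) * poch (((n : ℝ) - 1) / 2) (ℓ - j) /
      ((Nat.factorial (ℓ - j)) * 2 ^ (ℓ - j) * (n : ℝ) ^ (((ℓ - j : ℕ) : ℝ) / 2)) *
    ((1 + ρ) / |rX + rY|) ^ (ℓ - j) *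
    ∑ i ∈ Finset.Icc ((j + 1) / 2) j,
      poch ((n : ℝ) / 2) i * ((1 - ρ ^ 2) / 2) ^ i *
        hypM ((n : ℝ) / 2 + i) ((n : ℝ) / 2) ((n : ℝ) / 8 * ((1 + ρ) / (1 - ρ)) * (rX - rY) ^ 2) *
        puiseuxG (((n : ℝ) - 3) / 4 - ((ℓ - j : ℕ) : ℝ) / 2)
          (|rX + rY| / (1 + ρ) * Real.sqrt n) i j

/-- The coefficient `c_ℓ(r_X, r_Y, ρ, n)`. -/
def cCoef (rX rY ρ : ℝ) (n : ℕ) (ℓ : ℕ) : ℝ :=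
  if ℓ = 0 then 1
  else Real.exp (-((n : ℝ) / 8 * ((1 + ρ) / (1 - ρ)) * (rX - rY) ^ 2)) *
    ∑ j ∈ Finset.range (ℓ + 1), hCoef rX rY ρ n j ℓ

/-- The coefficient `d_k(r_X, ρ, n)`. -/
def dCoef (rX ρ : ℝ) (n : ℕ) (k : ℕ) : ℝ :=
  if k = 0 then 1
  else (-1 : ℝ) ^ k * poch (1 - (n : ℝ) / 2) k * poch ((n : ℝ) / 2) k / (Nat.factorial k) *
    ((1 - ρ ^ 2) / 2) ^ k *
    ∑ j ∈ Finset.range (k + 1),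
      ((n : ℝ) / 2) ^ j / poch ((n : ℝ) / 2) j * (Nat.choose k j) *
        ((1 + ρ) / (1 - ρ)) ^ j * rX ^ (2 * j)

/-- The coefficient `γ_p(r_X, r_Y, ρ, n)`. -/
def gammaCoef (rX rY ρ : ℝ) (n : ℕ) (p : ℕ) : ℝ :=
  if p = 0 then 1
  else
    ∑ i ∈ Finset.range (p + 1), ∑ j ∈ Finset.range (p + 1),
      ∑ k ∈ Finset.range (p + 1), ∑ ℓ ∈ Finset.range (p + 1),
        if i + 2 * j + k + ℓ = p then
          (-1 : ℝ) ^ (j + i) * cCoef rX rY ρ n ℓ * genBinom (((n : ℝ) - 1) / 2 - ℓ) k *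
            genBinom (((n : ℝ) - 3) / 2 - ℓ - k - 2 * j) i *
            poch (((ℓ : ℝ) + k) / 2 - ((n : ℝ) - 3) / 4) j * (1 + ρ) ^ j *
            (|rX + rY| * Real.sqrt n / 2) ^ (k + i)
        else 0

/-- The coefficient `δ_k(r_X, ρ, n)`. -/
def deltaCoef (rX ρ : ℝ) (n : ℕ) (k : ℕ) : ℝ :=
  if k = 0 then 1
  else
    ∑ j ∈ Finset.range (k + 1),
      (-1 : ℝ) ^ (k - j) * dCoef rX ρ n j * poch ((k : ℝ) + 1 - (n : ℝ) / 2) (k - j) *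
        (1 + ρ) ^ (k - j)

/-- Joint density of a bivariate normal random vector with means `(μX, μY)`,
variances `(σX², σY²)` and correlation coefficient `ρ`. -/
def biNormPDF (μX μY σX σY ρ : ℝ) (v : ℝ × ℝ) : ℝ :=
  (2 * Real.pi * σX * σY * Real.sqrt (1 - ρ ^ 2))⁻¹ *
    Real.exp (-(2 * (1 - ρ ^ 2))⁻¹ *
      (((v.1 - μX) / σX) ^ 2 - 2 * ρ * ((v.1 - μX) / σX) * ((v.2 - μY) / σY) +
        ((v.2 - μY) / σY) ^ 2))

/-- The law of `S_n = ∑_{i=1}^n X_i Y_i`, where `(X_i, Y_i)` are independent bivariate normal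
random vectors with means `(μX, μY)`, variances `(σX², σY²)` and correlation coefficient `ρ`. -/
def prodLaw (μX μY σX σY ρ : ℝ) (n : ℕ) : Measure ℝ :=
  Measure.map (fun v : Fin n → ℝ × ℝ => ∑ i, (v i).1 * (v i).2)
    (Measure.pi fun _ : Fin n =>
      (volume : Measure (ℝ × ℝ)).withDensity fun v => ENNReal.ofReal (biNormPDF μX μY σX σY ρ v))

/-- `f` has the asymptotic expansion `∑ c p * t⁻ᵖ` as `t → ∞`. -/
def AsympExp (f : ℝ → ℝ) (c : ℕ → ℝ) : Prop :=
  ∀ N : ℕ, (fun t => f t - ∑ p ∈ range N, c p * t⁻¹ ^ p) =O[atTop] fun t => t⁻¹ ^ N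

lemma isBigO_inv_pow_of_le {M N : ℕ} (h : M ≤ N) :
    (fun t : ℝ => t⁻¹ ^ N) =O[atTop] fun t => t⁻¹ ^ M := by
  refine IsBigO.of_bound 1 ?_
  filter_upwards [eventually_ge_atTop 1] with t ht
  have h0 : 0 ≤ t⁻¹ := by positivity
  rw [one_mul, Real.norm_of_nonneg (by positivity), Real.norm_of_nonneg (by positivity)]
  exact pow_le_pow_of_le_one h0 (inv_le_one_of_one_le₀ ht) h

lemma isBigO_sum_inv_pow (c : ℕ → ℝ) {M N K : ℕ} (h : M ≤ N) :
    (fun t : ℝ => ∑ p ∈ Ico N K, c p * t⁻¹ ^ p) =O[atTop] fun t => t⁻¹ ^ M := by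
  refine IsBigO.fun_sum fun p hp => ?_
  exact (isBigO_inv_pow_of_le (h.trans (mem_Ico.1 hp).1)).const_mul_left _

namespace AsympExp

lemma of_large {f : ℝ → ℝ} {c : ℕ → ℝ} (h : ∀ N : ℕ, ∃ K, N ≤ K ∧
    (fun t => f t - ∑ p ∈ range K, c p * t⁻¹ ^ p) =O[atTop] fun t => t⁻¹ ^ N) :
    AsympExp f c := by
  intro N
  obtain ⟨K, hK, hO⟩ := h N
  refine (hO.add (isBigO_sum_inv_pow c (le_refl N) (K := K))).congr_left fun t => ?_
  rw [← Finset.sum_range_add_sum_Ico _ hK]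
  ring

lemma congr' {f g : ℝ → ℝ} {c : ℕ → ℝ} (h : AsympExp f c) (hfg : f =ᶠ[atTop] g) :
    AsympExp g c := fun N =>
  (h N).congr' (hfg.mono fun t ht => by simp only [ht]) EventuallyEq.rfl

lemma congr_coeff {f : ℝ → ℝ} {c d : ℕ → ℝ} (h : AsympExp f c) (hcd : ∀ p, c p = d p) :
    AsympExp f d := (funext hcd : c = d) ▸ h

lemma isBigO_one {f : ℝ → ℝ} {c : ℕ → ℝ} (h : AsympExp f c) :
    f =O[atTop] fun _ => (1 : ℝ) := by
  simpa using h 0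

lemma const_mul {f : ℝ → ℝ} {c : ℕ → ℝ} (h : AsympExp f c) (a : ℝ) :
    AsympExp (fun t => a * f t) (fun p => a * c p) := fun N => by
  refine ((h N).const_mul_left a).congr_left fun t => ?_
  rw [mul_sub, Finset.mul_sum]
  simp only [mul_assoc]

lemma shift {f : ℝ → ℝ} {c : ℕ → ℝ} (h : AsympExp f c) (m : ℕ) :
    AsympExp (fun t => t⁻¹ ^ m * f t) (fun p => if m ≤ p then c (p - m) else 0) := by
  refine of_large fun N => ⟨N + m, by omega, ?_⟩
  have h1 := (isBigO_refl (fun t : ℝ => t⁻¹ ^ m) atTop).mul (h N)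
  refine (h1.congr_left fun t => ?_).trans ?_
  · rw [mul_sub, add_comm N m, Finset.sum_range_add, Finset.mul_sum]
    rw [Finset.sum_eq_zero (s := range m), zero_add]
    · congr 1
      refine Finset.sum_congr rfl fun p _ => ?_
      simp [pow_add]; ring
    · intro p hp
      simp [not_le.2 (mem_range.1 hp)]
  · simp only [← pow_add]
    exact isBigO_inv_pow_of_le (by omega)

/-- An expansion whose terms have asymptotic expansions starting at increasing orders. -/
lemma nested {f : ℝ → ℝ} {F : ℕ → ℝ → ℝ} {d : ℕ → ℕ → ℝ}
    (hf : ∀ N : ℕ, (fun t => f t - ∑ k ∈ range N, F k t) =O[atTop] fun t => t⁻¹ ^ N)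
    (hF : ∀ k, AsympExp (F k) (d k)) (hd : ∀ k p, p < k → d k p = 0) :
    AsympExp f (fun p => ∑ k ∈ range (p + 1), d k p) := by
  intro N
  have h2 : (fun t => ∑ k ∈ range N, (F k t - ∑ p ∈ range N, d k p * t⁻¹ ^ p))
      =O[atTop] fun t => t⁻¹ ^ N := IsBigO.fun_sum fun k _ => hF k N
  refine ((hf N).add h2).congr_left fun t => ?_
  rw [Finset.sum_sub_distrib, Finset.sum_comm]
  have : ∀ p ∈ range N, ∑ k ∈ range N, d k p * t⁻¹ ^ p =
      (∑ k ∈ range (p + 1), d k p) * t⁻¹ ^ p := by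
    intro p hp
    rw [Finset.sum_mul]
    symm
    refine Finset.sum_subset (Finset.range_subset_range.2 (mem_range.1 hp)) fun k _ hk => ?_
    rw [hd k p (by simpa using hk), zero_mul]
  rw [Finset.sum_congr rfl this]
  ring

lemma mul {f g : ℝ → ℝ} {c d : ℕ → ℝ} (hf : AsympExp f c) (hg : AsympExp g d) :
    AsympExp (fun t => f t * g t) (fun p => ∑ k ∈ range (p + 1), c k * d (p - k)) := by
  refine (nested (F := fun k t => c k * (t⁻¹ ^ k * g t))
    (d := fun k p => c k * if k ≤ p then d (p - k) else 0) ?_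
    (fun k => (hg.shift k).const_mul _) ?_).congr_coeff fun p => ?_
  · intro N
    refine ((hf N).mul hg.isBigO_one).congr (fun t => ?_) fun t => mul_one _
    rw [sub_mul, Finset.sum_mul]
    simp only [mul_assoc]
  · intro k p h
    simp [not_le.2 h]
  · refine Finset.sum_congr rfl fun k hk => ?_
    rw [if_pos (by simpa [Nat.lt_succ_iff] using hk)]

end AsympExp

lemma genBinom_eq_choose (a : ℝ) (k : ℕ) : genBinom a k = Ring.choose a k := by
  have h : (descPochhammer ℤ k).smeval a = ∏ t ∈ range k, (a - t) := by
    induction k with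
    | zero => simp
    | succ k ih =>
      rw [descPochhammer_succ_right, Polynomial.smeval_mul, ih, Finset.prod_range_succ]
      simp [Polynomial.smeval_sub, Polynomial.smeval_natCast]
  rw [genBinom, Ring.choose_eq_smul, h, div_eq_inv_mul, smul_eq_mul]

lemma isBigO_one_add_rpow_sub (a : ℝ) (N : ℕ) :
    (fun w : ℝ => (1 + w) ^ a - ∑ k ∈ range N, genBinom a k * w ^ k) =O[𝓝 0] fun w => w ^ N := by
  have h := (Real.one_add_rpow_hasFPowerSeriesAt_zero (a := a)).isBigO_sub_partialSum_pow N
  simp only [zero_add] at h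
  refine (h.congr_left fun w => ?_).trans (IsBigO.of_bound 1 ?_)
  · simp [FormalMultilinearSeries.partialSum, genBinom_eq_choose, binomialSeries,
      FormalMultilinearSeries.coeff_ofScalars, mul_comm]
  · simp

lemma asympExp_one_add_div_rpow (a b : ℝ) :
    AsympExp (fun t => (1 + b / t) ^ a) (fun k => genBinom a k * b ^ k) := by
  intro N
  have ht : Tendsto (fun t : ℝ => b / t) atTop (𝓝 0) := tendsto_const_nhds.div_atTop tendsto_id
  refine (((isBigO_one_add_rpow_sub a N).comp_tendsto ht).congr_left fun t => ?_).trans ?_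
  · simp [div_eq_mul_inv, mul_pow, mul_assoc]
  · simp only [Function.comp_def, div_eq_mul_inv, mul_pow]
    exact (isBigO_refl _ _).const_mul_left _

/-- Translating the argument of `t ^ m * φ t`. -/
lemma AsympExp.translate {φ : ℝ → ℝ} {c : ℕ → ℝ} (h : AsympExp φ c) (m b : ℝ) :
    AsympExp (fun t => (1 + b / t) ^ m * φ (t + b))
      (fun p => ∑ l ∈ range (p + 1), c l * (genBinom (m - l) (p - l) * b ^ (p - l))) := by
  refine (nested (F := fun l t => c l * (t⁻¹ ^ l * (1 + b / t) ^ (m - l)))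
    (d := fun l p => c l * if l ≤ p then genBinom (m - l) (p - l) * b ^ (p - l) else 0) ?_
    (fun l => ((asympExp_one_add_div_rpow (m - l) b).shift l).const_mul _) ?_).congr_coeff
      fun p => ?_
  · intro N
    have ht : Tendsto (fun t : ℝ => t + b) atTop atTop := tendsto_atTop_add_const_right _ b tendsto_id
    have h1 := (h N).comp_tendsto ht
    have hw : Tendsto (fun t : ℝ => 1 + b / t) atTop (𝓝 1) := by
      simpa using (tendsto_const_nhds (x := (1:ℝ))).add
        ((tendsto_const_nhds (x := b)).div_atTop (tendsto_id (α := ℝ)))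
    have key : ∀ᶠ t : ℝ in atTop, 0 < t ∧ 0 < 1 + b / t :=
      (eventually_gt_atTop 0).and (hw.eventually (lt_mem_nhds one_pos))
    have e1 : ∀ t : ℝ, 0 < t → 0 < 1 + b / t → ∀ l : ℕ,
        (t + b)⁻¹ ^ l = t⁻¹ ^ l * (1 + b / t) ^ (-(l : ℝ)) := by
      intro t h0 h1 l
      have : t + b = t * (1 + b / t) := by field_simp
      rw [this, mul_inv, mul_pow, Real.rpow_neg h1.le, Real.rpow_natCast, inv_pow (1 + b / t)]
    have h3 : (fun t : ℝ => (1 + b / t) ^ m) =O[atTop] fun _ => (1 : ℝ) :=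
      (asympExp_one_add_div_rpow m b).isBigO_one
    have h4 : (fun t : ℝ => (1 + b / t) ^ (-(N : ℝ))) =O[atTop] fun _ => (1 : ℝ) :=
      (asympExp_one_add_div_rpow _ b).isBigO_one
    have h5 : (fun t : ℝ => (t + b)⁻¹ ^ N) =O[atTop] fun t => t⁻¹ ^ N := by
      refine ((isBigO_refl (fun t : ℝ => t⁻¹ ^ N) atTop).mul h4).congr' ?_ (by simp)
      filter_upwards [key] with t ht
      rw [e1 t ht.1 ht.2]
    refine (h3.mul (h1.trans h5)).congr' ?_ (by simp)
    filter_upwards [key] with t ht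
    simp only [Function.comp, mul_sub, Finset.mul_sum]
    congr 1
    refine Finset.sum_congr rfl fun l _ => ?_
    rw [e1 t ht.1 ht.2, sub_eq_add_neg, Real.rpow_add ht.2]
    ring
  · intro k p h
    simp [not_le.2 h]
  · refine Finset.sum_congr rfl fun k hk => ?_
    rw [if_pos (by simpa [Nat.lt_succ_iff] using hk)]

lemma poch_zero (v : ℝ) : poch v 0 = 1 := by simp [poch]

lemma poch_succ' (v : ℝ) (j : ℕ) : poch v (j + 1) = v * poch (v + 1) j := by
  rw [poch, poch, Finset.prod_range_succ']
  simp only [Nat.cast_add, Nat.cast_one, Nat.cast_zero, add_zero]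
  rw [mul_comm]
  congr 1
  refine Finset.prod_congr rfl fun t _ => by ring

lemma integrableOn_rpow_mul_exp_neg_sq {θ : ℝ} (hθ : 0 < θ) (q : ℝ) {T : ℝ} (hT : 0 < T) :
    IntegrableOn (fun t : ℝ => t ^ q * Real.exp (-t ^ 2 / θ)) (Set.Ioi T) := by
  have h0 : Integrable (fun t : ℝ => t ^ (max q 0) * Real.exp (-θ⁻¹ * t ^ 2)) :=
    integrable_rpow_mul_exp_neg_mul_sq (inv_pos.2 hθ) (by
      have := le_max_right q 0; linarith)
  refine Integrable.mono' ((h0.integrableOn (s := Set.Ioi T)).const_mul (T ^ (q - max q 0))) ?_ ?_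
  · exact ((measurable_id.pow_const q).mul (by fun_prop)).aestronglyMeasurable
  · refine (ae_restrict_mem measurableSet_Ioi).mono fun t ht => ?_
    have ht' : 0 < t := hT.trans ht
    rw [Real.norm_of_nonneg (by positivity), ← mul_assoc]
    have : -t ^ 2 / θ = -θ⁻¹ * t ^ 2 := by field_simp
    rw [this]
    gcongr
    calc t ^ q = t ^ (q - max q 0) * t ^ max q 0 := by rw [← Real.rpow_add ht']; ring_nf
      _ ≤ T ^ (q - max q 0) * t ^ max q 0 := by
        gcongr ?_ * _
        exact Real.rpow_le_rpow_of_nonpos hT (le_of_lt ht) (by simp)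

/-- The normalised tail integral of `t ^ q * exp (-t ^ 2 / θ)`. -/
def gaussTail (θ q T : ℝ) : ℝ :=
  T ^ (1 - q) * Real.exp (T ^ 2 / θ) * ∫ t in Set.Ioi T, t ^ q * Real.exp (-t ^ 2 / θ)

lemma tendsto_rpow_mul_exp_neg_sq {θ : ℝ} (hθ : 0 < θ) (q : ℝ) :
    Tendsto (fun t : ℝ => t ^ q * Real.exp (-t ^ 2 / θ)) atTop (𝓝 0) := by
  have h := (rpow_mul_exp_neg_mul_sq_isLittleO_exp_neg (inv_pos.2 hθ) q).trans_tendsto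
    (show Tendsto (fun x : ℝ => Real.exp (-(1 / 2 : ℝ) * x)) atTop (𝓝 0) from
      Real.tendsto_exp_atBot.comp ((tendsto_id).const_mul_atTop_of_neg (by norm_num)))
  refine h.congr fun t => ?_
  have : -t ^ 2 / θ = -θ⁻¹ * t ^ 2 := by field_simp
  rw [this]

lemma gaussTail_recurrence {θ : ℝ} (hθ : 0 < θ) (q : ℝ) {T : ℝ} (hT : 0 < T) :
    gaussTail θ q T = θ / 2 + θ / 2 * (q - 1) * T⁻¹ ^ 2 * gaussTail θ (q - 2) T := by
  have i1 := integrableOn_rpow_mul_exp_neg_sq hθ q hT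
  have i2 := integrableOn_rpow_mul_exp_neg_sq hθ (q - 2) hT
  have key := integral_Ioi_of_hasDerivAt_of_tendsto
    (f := fun t : ℝ => t ^ (q - 1) * Real.exp (-t ^ 2 / θ))
    (f' := fun t => (q - 1) * (t ^ (q - 2) * Real.exp (-t ^ 2 / θ))
      - 2 / θ * (t ^ q * Real.exp (-t ^ 2 / θ))) (a := T) (m := 0) ?_ ?_
      ((i2.const_mul _).sub (i1.const_mul _)) (tendsto_rpow_mul_exp_neg_sq hθ _)
  · rw [integral_sub (i2.const_mul _) (i1.const_mul _), integral_const_mul, integral_const_mul]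
      at key
    have e1 : T ^ (1 - q) * T ^ (q - 1) = 1 := by rw [← Real.rpow_add hT]; simp
    have e2 : Real.exp (T ^ 2 / θ) * Real.exp (-T ^ 2 / θ) = 1 := by
      rw [← Real.exp_add]; simp [neg_div]
    have e3 : T ^ (1 - (q - 2)) = T ^ (1 - q) * T ^ 2 := by
      rw [← Real.rpow_natCast, ← Real.rpow_add hT]; congr 1; push_cast; ring
    unfold gaussTail
    rw [e3]
    set A := ∫ t in Set.Ioi T, t ^ q * Real.exp (-t ^ 2 / θ)
    set B := ∫ t in Set.Ioi T, t ^ (q - 2) * Real.exp (-t ^ 2 / θ)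
    have hA : A = θ / 2 * (T ^ (q - 1) * Real.exp (-T ^ 2 / θ)) + θ / 2 * (q - 1) * B := by
      field_simp at key ⊢
      linarith
    rw [hA, mul_add]
    have e4 : T ^ (1 - q) * Real.exp (T ^ 2 / θ) * (θ / 2 * (T ^ (q - 1) * Real.exp (-T ^ 2 / θ)))
      = θ / 2 * ((T ^ (1 - q) * T ^ (q - 1)) * (Real.exp (T ^ 2 / θ) * Real.exp (-T ^ 2 / θ))) := by
      ring
    rw [e4, e1, e2]
    field_simp
  · have h1 : ContinuousAt (fun t : ℝ => t ^ (q - 1) * Real.exp (-t ^ 2 / θ)) T := by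
      refine (Real.continuousAt_rpow_const _ _ (Or.inl hT.ne')).mul ?_
      fun_prop
    exact h1.continuousWithinAt
  · intro t ht
    have ht' : 0 < t := hT.trans ht
    have d1 : HasDerivAt (fun t : ℝ => t ^ (q - 1)) ((q - 1) * t ^ (q - 1 - 1)) t :=
      Real.hasDerivAt_rpow_const (Or.inl ht'.ne')
    have d2 : HasDerivAt (fun t : ℝ => Real.exp (-t ^ 2 / θ))
        (Real.exp (-t ^ 2 / θ) * (-(2 * t) / θ)) t := by
      have := ((hasDerivAt_pow 2 t).neg.div_const θ).exp
      simpa using this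
    refine (d1.mul d2).congr_deriv ?_
    have e : t ^ q = t ^ (q - 1) * t := by
      rw [← Real.rpow_add_one ht'.ne']; ring_nf
    rw [e, show q - 1 - 1 = q - 2 by ring]
    ring

lemma gaussTail_isBigO_one {θ : ℝ} (hθ : 0 < θ) (q : ℝ) :
    gaussTail θ q =O[atTop] fun _ => (1 : ℝ) := by
  have base : ∀ q ≤ (1 : ℝ), gaussTail θ q =O[atTop] fun _ => (1 : ℝ) := by
    intro q hq
    refine IsBigO.of_bound (θ / 2) ?_
    filter_upwards [eventually_gt_atTop 0] with T hT
    have h1 := gaussTail_recurrence hθ 1 hT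
    simp only [sub_self, mul_zero, zero_mul, add_zero] at h1
    have hle : gaussTail θ q T ≤ gaussTail θ 1 T := by
      unfold gaussTail
      simp only [sub_self, Real.rpow_zero, one_mul]
      have : ∫ t in Set.Ioi T, t ^ q * Real.exp (-t ^ 2 / θ) ≤
          ∫ t in Set.Ioi T, T ^ (q - 1) * (t ^ (1 : ℝ) * Real.exp (-t ^ 2 / θ)) := by
        refine setIntegral_mono_on (integrableOn_rpow_mul_exp_neg_sq hθ q hT)
          ((integrableOn_rpow_mul_exp_neg_sq hθ 1 hT).const_mul _) measurableSet_Ioi ?_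
        intro t ht
        have ht' : 0 < t := hT.trans ht
        rw [← mul_assoc]
        gcongr
        calc t ^ q = t ^ (q - 1) * t ^ (1 : ℝ) := by rw [← Real.rpow_add ht']; ring_nf
          _ ≤ _ := by
            gcongr ?_ * _
            exact Real.rpow_le_rpow_of_nonpos hT (le_of_lt ht) (by linarith)
      calc _ ≤ T ^ (1 - q) * Real.exp (T ^ 2 / θ) *
          ∫ t in Set.Ioi T, T ^ (q - 1) * (t ^ (1 : ℝ) * Real.exp (-t ^ 2 / θ)) := by gcongr
        _ = (T ^ (1 - q) * T ^ (q - 1)) * (Real.exp (T ^ 2 / θ) *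
          ∫ t in Set.Ioi T, t ^ (1 : ℝ) * Real.exp (-t ^ 2 / θ)) := by
            rw [integral_const_mul]; ring
        _ = _ := by rw [← Real.rpow_add hT]; simp
    have h0 : 0 ≤ gaussTail θ q T := by
      unfold gaussTail
      have : 0 ≤ ∫ t in Set.Ioi T, t ^ q * Real.exp (-t ^ 2 / θ) :=
        setIntegral_nonneg measurableSet_Ioi fun t ht => by
          have ht' : 0 < t := hT.trans ht
          positivity
      positivity
    rw [Real.norm_of_nonneg h0]
    simpa using hle.trans_eq h1
  have step : ∀ k : ℕ, ∀ q ≤ (1 : ℝ) + 2 * k, gaussTail θ q =O[atTop] fun _ => (1 : ℝ) := by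
    intro k
    induction k with
    | zero => simpa using base
    | succ k ih =>
      intro q hq
      have h1 := ih (q - 2) (by push_cast at hq; linarith)
      have h2 : (fun T : ℝ => T⁻¹ ^ 2) =O[atTop] fun _ => (1 : ℝ) := by
        simpa using isBigO_inv_pow_of_le (Nat.zero_le 2)
      have h3 : (fun T : ℝ => θ / 2 * (q - 1) * T⁻¹ ^ 2 * gaussTail θ (q - 2) T)
          =O[atTop] fun _ => (1 : ℝ) := by
        simpa using (h2.const_mul_left (θ / 2 * (q - 1))).mul h1
      refine ((isBigO_const_const (θ / 2) one_ne_zero atTop).add h3).congr' ?_ EventuallyEq.rfl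
      filter_upwards [eventually_gt_atTop 0] with T hT
      rw [gaussTail_recurrence hθ q hT]
  obtain ⟨k, hk⟩ := exists_nat_ge q
  refine step k q ?_
  have : (0:ℝ) ≤ k := Nat.cast_nonneg k
  linarith

lemma gaussTail_expansion {θ : ℝ} (hθ : 0 < θ) (J : ℕ) : ∀ q : ℝ,
    (fun T => gaussTail θ q T -
      ∑ j ∈ range J, θ / 2 * ((-1) ^ j * θ ^ j * poch ((1 - q) / 2) j) * T⁻¹ ^ (2 * j))
      =O[atTop] fun T => T⁻¹ ^ (2 * J) := by
  induction J with
  | zero => intro q; simpa using gaussTail_isBigO_one hθ q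
  | succ J ih =>
    intro q
    have h2 := ((isBigO_refl (fun T : ℝ => T⁻¹ ^ 2) atTop).const_mul_left (θ / 2 * (q - 1))).mul
      (ih (q - 2))
    refine (h2.congr' ?_ (Eventually.of_forall fun T => by simp only; ring))
    filter_upwards [eventually_gt_atTop 0] with T hT
    rw [gaussTail_recurrence hθ q hT, Finset.sum_range_succ', mul_sub, Finset.mul_sum]
    simp only [poch_zero, pow_zero, mul_one, mul_zero]
    have : ∀ j ∈ range J, θ / 2 * ((-1) ^ (j + 1) * θ ^ (j + 1) * poch ((1 - q) / 2) (j + 1)) *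
        T⁻¹ ^ (2 * (j + 1)) = θ / 2 * (q - 1) * T⁻¹ ^ 2 *
        (θ / 2 * ((-1) ^ j * θ ^ j * poch ((1 - (q - 2)) / 2) j) * T⁻¹ ^ (2 * j)) := by
      intro j _
      rw [poch_succ', show (1 - (q - 2)) / 2 = (1 - q) / 2 + 1 by ring]
      ring
    rw [Finset.sum_congr rfl this]
    ring

lemma asympExp_gaussTail {θ : ℝ} (hθ : 0 < θ) (q : ℝ) :
    AsympExp (gaussTail θ q) (fun p => ∑ j ∈ range (p + 1), if 2 * j = p then
      θ / 2 * ((-1) ^ j * θ ^ j * poch ((1 - q) / 2) j) else 0) := by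
  refine AsympExp.nested
    (F := fun j T => θ / 2 * ((-1) ^ j * θ ^ j * poch ((1 - q) / 2) j) * T⁻¹ ^ (2 * j))
    (d := fun j p => if 2 * j = p then
      θ / 2 * ((-1) ^ j * θ ^ j * poch ((1 - q) / 2) j) else 0) ?_ ?_ ?_
  · intro N
    exact (gaussTail_expansion hθ N q).trans (isBigO_inv_pow_of_le (by omega))
  · intro j
    refine AsympExp.of_large fun N => ⟨N + 2 * j + 1, by omega, ?_⟩
    simp only [ite_mul, zero_mul, Finset.sum_ite_eq, Finset.mem_range]
    simp only [show 2 * j < N + 2 * j + 1 by omega, if_true, sub_self]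
    exact isBigO_zero _ _
  · intro k p h
    rw [if_neg (by omega)]

lemma asympExp_integral_gauss {θ : ℝ} (hθ : 0 < θ) (m : ℝ) {φ : ℝ → ℝ} {c : ℕ → ℝ}
    (hφ : AsympExp φ c) (hm : Measurable φ) :
    AsympExp (fun T => T ^ (1 - m) * Real.exp (T ^ 2 / θ) *
        ∫ t in Set.Ioi T, t ^ m * Real.exp (-t ^ 2 / θ) * φ t)
      (fun p => ∑ q ∈ range (p + 1), c q * ∑ j ∈ range (p - q + 1), if 2 * j = p - q then
        θ / 2 * ((-1) ^ j * θ ^ j * poch ((1 - (m - q)) / 2) j) else 0) := by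
  refine (AsympExp.nested (F := fun q T => c q * (T⁻¹ ^ q * gaussTail θ (m - q) T)) (d := fun q p =>
    c q * if q ≤ p then ∑ j ∈ range (p - q + 1), if 2 * j = p - q then
        θ / 2 * ((-1) ^ j * θ ^ j * poch ((1 - (m - q)) / 2) j) else 0 else 0) ?_ ?_
        ?_).congr_coeff ?_
  · intro N
    obtain ⟨C, hC⟩ := (hφ N).bound
    obtain ⟨C0, hC0⟩ := hφ.isBigO_one.bound
    obtain ⟨T0, hT0⟩ := eventually_atTop.1 (hC.and hC0)
    have h1 : (fun T : ℝ => C * (T⁻¹ ^ N * gaussTail θ (m - N) T)) =O[atTop] fun T => T⁻¹ ^ N := by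
      simpa using ((isBigO_refl (fun T : ℝ => T⁻¹ ^ N) atTop).mul
        (gaussTail_isBigO_one hθ (m - N))).const_mul_left C
    refine IsBigO.trans (IsBigO.of_bound 1 ?_) h1
    filter_upwards [eventually_gt_atTop 0, eventually_ge_atTop T0] with T hT hTT
    have e1 : ∀ q : ℕ, ∀ t : ℝ, 0 < t → t ^ (m - q) = t ^ m * t⁻¹ ^ q := by
      intro q t ht
      rw [Real.rpow_sub ht, Real.rpow_natCast, inv_pow, div_eq_mul_inv]
    have e2 : ∀ q : ℕ, T⁻¹ ^ q * gaussTail θ (m - q) T = T ^ (1 - m) * Real.exp (T ^ 2 / θ) *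
        ∫ t in Set.Ioi T, t ^ m * Real.exp (-t ^ 2 / θ) * t⁻¹ ^ q := by
      intro q
      unfold gaussTail
      rw [show 1 - (m - (q:ℝ)) = (1 - m) + q by ring, Real.rpow_add hT, Real.rpow_natCast]
      have : ∫ t in Set.Ioi T, t ^ (m - (q : ℝ)) * Real.exp (-t ^ 2 / θ) =
          ∫ t in Set.Ioi T, t ^ m * Real.exp (-t ^ 2 / θ) * t⁻¹ ^ q :=
        setIntegral_congr_fun measurableSet_Ioi fun t ht => by
          rw [e1 q t (hT.trans ht)]; ring
      rw [this]
      have : T⁻¹ ^ q * T ^ q = 1 := by rw [← mul_pow, inv_mul_cancel₀ hT.ne', one_pow]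
      linear_combination (T ^ (1 - m) * Real.exp (T ^ 2 / θ) *
        ∫ t in Set.Ioi T, t ^ m * Real.exp (-t ^ 2 / θ) * t⁻¹ ^ q) * this
    have iq : ∀ q : ℕ, IntegrableOn (fun t => t ^ m * Real.exp (-t ^ 2 / θ) * t⁻¹ ^ q)
        (Set.Ioi T) := by
      intro q
      refine (integrableOn_rpow_mul_exp_neg_sq hθ (m - q) hT).congr_fun ?_ measurableSet_Ioi
      intro t ht
      beta_reduce; rw [e1 q t (hT.trans ht)]; ring
    have iφ : IntegrableOn (fun t => t ^ m * Real.exp (-t ^ 2 / θ) * φ t) (Set.Ioi T) := by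
      refine Integrable.mono' ((integrableOn_rpow_mul_exp_neg_sq hθ m hT).const_mul C0) ?_ ?_
      · exact (((measurable_id.pow_const m).mul (by fun_prop)).mul hm).aestronglyMeasurable
      · refine (ae_restrict_mem measurableSet_Ioi).mono fun t ht => ?_
        have ht' : 0 < t := hT.trans ht
        have := (hT0 t (hTT.trans (le_of_lt ht))).2
        rw [norm_one, mul_one] at this
        rw [norm_mul, Real.norm_of_nonneg (by positivity), mul_comm]
        gcongr
    have hsum : ∀ q ∈ range N, IntegrableOn
        (fun t => c q * (t ^ m * Real.exp (-t ^ 2 / θ) * t⁻¹ ^ q)) (Set.Ioi T) :=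
      fun q _ => (iq q).const_mul _
    have e3 : ∑ q ∈ range N, c q * (T⁻¹ ^ q * gaussTail θ (m - q) T) =
        T ^ (1 - m) * Real.exp (T ^ 2 / θ) * ∫ t in Set.Ioi T,
          ∑ q ∈ range N, c q * (t ^ m * Real.exp (-t ^ 2 / θ) * t⁻¹ ^ q) := by
      rw [integral_finsetSum _ hsum, Finset.mul_sum]
      refine Finset.sum_congr rfl fun q _ => ?_
      rw [e2, integral_const_mul]; ring
    rw [e3, ← mul_sub, ← integral_sub iφ (integrable_finsetSum _ hsum), e2, one_mul]
    have hP : 0 ≤ T ^ (1 - m) * Real.exp (T ^ 2 / θ) := by positivity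
    have hb : ‖∫ t in Set.Ioi T, (t ^ m * Real.exp (-t ^ 2 / θ) * φ t -
        ∑ q ∈ range N, c q * (t ^ m * Real.exp (-t ^ 2 / θ) * t⁻¹ ^ q))‖ ≤
        ∫ t in Set.Ioi T, C * (t ^ m * Real.exp (-t ^ 2 / θ) * t⁻¹ ^ N) := by
      refine norm_integral_le_of_norm_le ((iq N).const_mul C) ?_
      refine (ae_restrict_mem measurableSet_Ioi).mono fun t ht => ?_
      have ht' : 0 < t := hT.trans ht
      have := (hT0 t (hTT.trans (le_of_lt ht))).1
      rw [Real.norm_of_nonneg (show 0 ≤ t⁻¹ ^ N by positivity)] at this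
      calc _ = ‖t ^ m * Real.exp (-t ^ 2 / θ) * (φ t - ∑ q ∈ range N, c q * t⁻¹ ^ q)‖ := by
            rw [mul_sub, Finset.mul_sum]
            congr 2
            exact Finset.sum_congr rfl fun q _ => by ring
        _ = t ^ m * Real.exp (-t ^ 2 / θ) * ‖φ t - ∑ q ∈ range N, c q * t⁻¹ ^ q‖ := by
            rw [norm_mul, Real.norm_of_nonneg (by positivity)]
        _ ≤ t ^ m * Real.exp (-t ^ 2 / θ) * (C * t⁻¹ ^ N) := by gcongr
        _ = _ := by ring
    calc _ = T ^ (1 - m) * Real.exp (T ^ 2 / θ) * ‖∫ t in Set.Ioi T,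
          (t ^ m * Real.exp (-t ^ 2 / θ) * φ t -
          ∑ q ∈ range N, c q * (t ^ m * Real.exp (-t ^ 2 / θ) * t⁻¹ ^ q))‖ := by
            rw [norm_mul, Real.norm_of_nonneg hP]
      _ ≤ T ^ (1 - m) * Real.exp (T ^ 2 / θ) *
          ∫ t in Set.Ioi T, C * (t ^ m * Real.exp (-t ^ 2 / θ) * t⁻¹ ^ N) := by gcongr
      _ = C * (T ^ (1 - m) * Real.exp (T ^ 2 / θ) *
          ∫ t in Set.Ioi T, t ^ m * Real.exp (-t ^ 2 / θ) * t⁻¹ ^ N) := by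
            rw [integral_const_mul]; ring
      _ ≤ _ := le_abs_self _
  · intro q
    exact ((asympExp_gaussTail hθ (m - q)).shift q).const_mul (c q)
  · intro k p h
    simp [not_le.2 h]
  · intro p
    refine Finset.sum_congr rfl fun k hk => ?_
    rw [if_pos (by simpa [Nat.lt_succ_iff] using hk)]

/-- Coefficients of the tail expansion before reindexing. -/
def tailCoef (θ m b : ℝ) (c : ℕ → ℝ) (p : ℕ) : ℝ :=
  ∑ r ∈ range (p + 1), (∑ q ∈ range (r + 1),
    (∑ l ∈ range (q + 1), c l * (genBinom (m - l) (q - l) * b ^ (q - l))) *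
      ∑ j ∈ range (r - q + 1), if 2 * j = r - q then
        θ / 2 * ((-1) ^ j * θ ^ j * poch ((1 - (m - q)) / 2) j) else 0) *
    (genBinom (m - 1 - r) (p - r) * (-b) ^ (p - r))

lemma asympExp_tail {θ : ℝ} (hθ : 0 < θ) (m b : ℝ) {φ : ℝ → ℝ} {c : ℕ → ℝ}
    (hφ : AsympExp φ c) (hm : Measurable φ) :
    AsympExp (fun t => t ^ (1 - m) * Real.exp (t ^ 2 / θ - 2 * b / θ * t) *
        ∫ τ in Set.Ioi t, τ ^ m * Real.exp (-τ ^ 2 / θ + 2 * b / θ * τ) * φ τ)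
      (tailCoef θ m b c) := by
  have hmeas : Measurable fun t => (1 + b / t) ^ m * φ (t + b) :=
    ((measurable_const.add (measurable_const.div measurable_id)).pow_const m).mul
      (hm.comp (measurable_id.add_const b))
  have h := (asympExp_integral_gauss hθ m (hφ.translate m b) hmeas).translate (m - 1) (-b)
  refine AsympExp.congr' h ?_
  filter_upwards [eventually_gt_atTop 0, eventually_gt_atTop b] with t ht htb
  have hT : 0 < t + -b := by linarith
  have hr : 1 + -b / t = (t + -b) / t := by field_simp
  have e1 : (1 + -b / t) ^ (m - 1) * (t + -b) ^ (1 - m) = t ^ (1 - m) := by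
    rw [hr, Real.div_rpow hT.le ht.le, show 1 - m = -(m - 1) by ring, Real.rpow_neg hT.le,
      Real.rpow_neg ht.le]
    have := (Real.rpow_pos_of_pos hT (m - 1)).ne'
    field_simp
  have e2 : ∫ τ in Set.Ioi t, τ ^ m * Real.exp (-τ ^ 2 / θ + 2 * b / θ * τ) * φ τ =
      Real.exp (b ^ 2 / θ) * ∫ τ in Set.Ioi (t + -b), τ ^ m * Real.exp (-τ ^ 2 / θ) *
        ((1 + b / τ) ^ m * φ (τ + b)) := by
    have := (measurePreserving_add_right volume b).setIntegral_preimage_emb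
      (measurableEmbedding_addRight b)
      (fun τ => τ ^ m * Real.exp (-τ ^ 2 / θ + 2 * b / θ * τ) * φ τ) (Set.Ioi t)
    rw [Set.preimage_add_const_Ioi, sub_eq_add_neg] at this
    rw [← this, ← integral_const_mul]
    refine setIntegral_congr_fun measurableSet_Ioi fun τ hτ => ?_
    have hτ' : 0 < τ := hT.trans hτ
    by_cases h0 : 0 ≤ τ + b
    · have e3 : τ ^ m * (1 + b / τ) ^ m = (τ + b) ^ m := by
        have : 0 ≤ 1 + b / τ := by
          rw [show 1 + b / τ = (τ + b) / τ by field_simp]; positivity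
        rw [← Real.mul_rpow hτ'.le this]
        congr 1
        field_simp
      have e4 : Real.exp (-(τ + b) ^ 2 / θ + 2 * b / θ * (τ + b)) =
          Real.exp (b ^ 2 / θ) * Real.exp (-τ ^ 2 / θ) := by
        rw [← Real.exp_add]
        congr 1
        field_simp
        ring
      rw [e4, ← e3]
      ring
    · exfalso
      have := Set.mem_Ioi.1 hτ
      linarith
  rw [e2, ← e1]
  have e5 : Real.exp ((t + -b) ^ 2 / θ) = Real.exp (t ^ 2 / θ - 2 * b / θ * t) *
      Real.exp (b ^ 2 / θ) := by
    rw [← Real.exp_add]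
    congr 1
    field_simp
    ring
  rw [e5]
  ring

lemma asympExp_const (x : ℝ) : AsympExp (fun _ => x) fun k => if k = 0 then x else 0 := by
  intro N
  rcases N with _ | N
  · simpa using isBigO_const_const x (one_ne_zero (α := ℝ)) (atTop : Filter ℝ)
  · simp [Finset.sum_ite_eq', ite_mul, Asymptotics.isBigO_zero]

/-- A local bound at the origin and a polynomial bound combine to a global bound. -/
lemma exists_bound_of_isBigO {f : ℝ → ℝ} {N M : ℕ} {C : ℝ}
    (h0 : f =O[𝓝[>] 0] fun v => v ^ N)
    (h : ∀ v, 0 < v → |f v| ≤ C * ((1 + v) ^ N * (1 + v) ^ M)) :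
    ∃ C', 0 ≤ C' ∧ ∀ v, 0 < v → |f v| ≤ C' * (v ^ N * (1 + v) ^ M) := by
  obtain ⟨C₀, hC₀, hb⟩ := h0.exists_nonneg
  obtain ⟨δ, hδ, hδb⟩ := mem_nhdsGT_iff_exists_Ioo_subset.1 hb.bound
  have hδ : 0 < δ := hδ
  have hC : 0 ≤ C := by
    have := (abs_nonneg _).trans (h 1 one_pos)
    by_contra hc
    have : C * ((1 + 1) ^ N * (1 + 1) ^ M) < 0 := mul_neg_of_neg_of_pos (not_le.1 hc) (by positivity)
    linarith
  refine ⟨C₀ + C * ((1 + δ) / δ) ^ N, by positivity, fun v hv => ?_⟩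
  have hM : 1 ≤ (1 + v) ^ M := one_le_pow₀ (by linarith)
  rcases lt_or_ge v δ with hvδ | hvδ
  · have h1 : |f v| ≤ C₀ * |v ^ N| := hδb ⟨hv, hvδ⟩
    rw [abs_of_pos (pow_pos hv N)] at h1
    calc |f v| ≤ C₀ * (v ^ N * 1) := by simpa using h1
      _ ≤ C₀ * (v ^ N * (1 + v) ^ M) := by gcongr
      _ ≤ _ := by gcongr; simp only [le_add_iff_nonneg_right]; positivity
  · have h1 : 1 + v ≤ (1 + δ) / δ * v := by
      rw [div_mul_eq_mul_div, le_div_iff₀ hδ]; nlinarith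
    calc |f v| ≤ C * ((1 + v) ^ N * (1 + v) ^ M) := h v hv
      _ ≤ C * (((1 + δ) / δ * v) ^ N * (1 + v) ^ M) := by gcongr
      _ = C * ((1 + δ) / δ) ^ N * (v ^ N * (1 + v) ^ M) := by rw [mul_pow]; ring
      _ ≤ _ := by gcongr; linarith

lemma integral_rpow_mul_exp_neg_mul {c z : ℝ} (hc : 0 < c) (hz : 0 < z) (k : ℕ) :
    ∫ v in Set.Ioi (0:ℝ), v ^ (c - 1) * Real.exp (-(z * v)) * v ^ k =
      z ^ (-c) * z⁻¹ ^ k * Real.Gamma (c + k) := by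
  have hck : 0 < c + k := by positivity
  have := Real.integral_rpow_mul_exp_neg_mul_Ioi hck hz
  rw [one_div, Real.inv_rpow hz.le, Real.rpow_add hz, mul_inv, Real.rpow_natCast, ← inv_pow,
    ← Real.rpow_neg hz.le] at this
  rw [← this]
  refine setIntegral_congr_fun measurableSet_Ioi fun v (hv : 0 < v) => ?_
  rw [show c + k - 1 = (c - 1) + k by ring, Real.rpow_add hv, Real.rpow_natCast]
  ring

lemma integrableOn_rpow_mul_exp_neg_mul {c z : ℝ} (hc : 0 < c) (hz : 0 < z) (k : ℕ) :
    IntegrableOn (fun v => v ^ (c - 1) * Real.exp (-(z * v)) * v ^ k) (Set.Ioi (0:ℝ)) := by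
  have := integral_rpow_mul_exp_neg_mul hc hz k
  refine not_not.1 fun h => ?_
  rw [integral_undef h] at this
  have h2 : 0 < c + k := by positivity
  have h3 := Real.Gamma_pos_of_pos h2
  have : 0 < z ^ (-c) * z⁻¹ ^ k * Real.Gamma (c + k) := by positivity
  linarith

/-- Watson's lemma for the Laplace transform of `v ^ (c - 1) * g v`. -/
lemma asympExp_laplace {c : ℝ} (hc : 0 < c) {g : ℝ → ℝ} {d : ℕ → ℝ} (hg : Measurable g)
    (h : ∀ N : ℕ, ∃ C, ∀ v, 0 < v → |g v - ∑ k ∈ range N, d k * v ^ k| ≤ C * v ^ N) :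
    AsympExp (fun z => z ^ c * ∫ v in Set.Ioi (0:ℝ), v ^ (c - 1) * Real.exp (-(z * v)) * g v)
      (fun k => d k * Real.Gamma (c + k)) := by
  intro N
  obtain ⟨C, hC⟩ := h N
  obtain ⟨C₀, hC₀⟩ := h 0
  refine IsBigO.of_bound (C * Real.Gamma (c + N)) ?_
  filter_upwards [eventually_gt_atTop 0] with z hz
  have hI : IntegrableOn (fun v => v ^ (c - 1) * Real.exp (-(z * v)) * g v) (Set.Ioi (0:ℝ)) := by
    have := (integrableOn_rpow_mul_exp_neg_mul hc hz 0).mul_const C₀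
    refine this.mono' (by fun_prop) ?_
    filter_upwards [self_mem_ae_restrict measurableSet_Ioi] with v (hv : 0 < v)
    have h1 := hC₀ v hv
    simp only [range_zero, sum_empty, sub_zero, pow_zero, mul_one] at h1 ⊢
    rw [Real.norm_eq_abs, abs_mul, abs_of_pos (by positivity)]
    gcongr
  have hS : ∀ k ∈ range N, IntegrableOn
      (fun v => d k * (v ^ (c - 1) * Real.exp (-(z * v)) * v ^ k)) (Set.Ioi (0:ℝ)) :=
    fun k _ => (integrableOn_rpow_mul_exp_neg_mul hc hz k).const_mul _
  have e : z ^ c * (∫ v in Set.Ioi (0:ℝ), v ^ (c - 1) * Real.exp (-(z * v)) * g v)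
      - ∑ k ∈ range N, d k * Real.Gamma (c + k) * z⁻¹ ^ k =
      z ^ c * ∫ v in Set.Ioi (0:ℝ), v ^ (c - 1) * Real.exp (-(z * v)) *
        (g v - ∑ k ∈ range N, d k * v ^ k) := by
    have : ∀ v : ℝ, v ^ (c - 1) * Real.exp (-(z * v)) * (g v - ∑ k ∈ range N, d k * v ^ k) =
        v ^ (c - 1) * Real.exp (-(z * v)) * g v -
          ∑ k ∈ range N, d k * (v ^ (c - 1) * Real.exp (-(z * v)) * v ^ k) := by
      intro v
      rw [mul_sub, Finset.mul_sum]
      congr 1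
      exact Finset.sum_congr rfl fun k _ => by ring
    simp_rw [this]
    rw [integral_sub hI (integrable_finsetSum _ hS), integral_finsetSum _ hS, mul_sub,
      Finset.mul_sum]
    congr 1
    refine Finset.sum_congr rfl fun k _ => ?_
    rw [integral_const_mul, integral_rpow_mul_exp_neg_mul hc hz, Real.rpow_neg hz.le]
    have := Real.rpow_pos_of_pos hz c
    field_simp
  rw [e, norm_mul, Real.norm_eq_abs, abs_of_pos (Real.rpow_pos_of_pos hz c), norm_pow,
    Real.norm_of_nonneg (inv_pos.2 hz).le]
  have h2 : ‖∫ v in Set.Ioi (0:ℝ), v ^ (c - 1) * Real.exp (-(z * v)) *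
        (g v - ∑ k ∈ range N, d k * v ^ k)‖ ≤
      ∫ v in Set.Ioi (0:ℝ), C * (v ^ (c - 1) * Real.exp (-(z * v)) * v ^ N) := by
    refine norm_integral_le_of_norm_le
      ((integrableOn_rpow_mul_exp_neg_mul hc hz N).const_mul C) ?_
    filter_upwards [self_mem_ae_restrict measurableSet_Ioi] with v (hv : 0 < v)
    rw [Real.norm_eq_abs, abs_mul, abs_of_pos (by positivity)]
    calc _ ≤ v ^ (c - 1) * Real.exp (-(z * v)) * (C * v ^ N) := by gcongr; exact hC v hv
      _ = _ := by ring
  rw [integral_const_mul, integral_rpow_mul_exp_neg_mul hc hz, Real.rpow_neg hz.le] at h2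
  calc _ ≤ z ^ c * (C * ((z ^ c)⁻¹ * z⁻¹ ^ N * Real.Gamma (c + N))) := by gcongr
    _ = _ := by
      have := Real.rpow_pos_of_pos hz c
      field_simp

lemma integral_beta {α β : ℝ} (hα : 0 < α) (hβ : 0 < β) :
    ∫ x in (0:ℝ)..1, x ^ (α - 1) * (1 - x) ^ (β - 1) =
      Real.Gamma α * Real.Gamma β / Real.Gamma (α + β) := by
  have h := ProbabilityTheory.beta_eq_betaIntegralReal α β hα hβ
  rw [ProbabilityTheory.beta] at h
  rw [h, Complex.betaIntegral]
  have : ∫ x in (0:ℝ)..1, (x:ℂ) ^ ((α:ℂ) - 1) * (1 - (x:ℂ)) ^ ((β:ℂ) - 1) =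
      ∫ x in (0:ℝ)..1, ((x ^ (α - 1) * (1 - x) ^ (β - 1) : ℝ) : ℂ) := by
    refine intervalIntegral.integral_congr fun x hx => ?_
    rw [Set.uIcc_of_le zero_le_one] at hx
    push_cast [Complex.ofReal_cpow hx.1, Complex.ofReal_cpow (sub_nonneg.2 hx.2)]
    rfl
  rw [this, intervalIntegral.integral_ofReal, Complex.ofReal_re]

/-- The weight `(1 - t ^ 2) ^ (c - 1)` on `t < 1`, extended by zero. -/
def semicircleWeight (c t : ℝ) : ℝ := (Set.Iio (1:ℝ)).indicator (fun t => (1 - t ^ 2) ^ (c - 1)) t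

lemma semicircleWeight_nonneg {c t : ℝ} (ht : 0 < t) : 0 ≤ semicircleWeight c t := by
  refine Set.indicator_apply_nonneg fun h => Real.rpow_nonneg ?_ _
  have h : t < 1 := h
  nlinarith

lemma measurable_semicircleWeight (c : ℝ) : Measurable (semicircleWeight c) :=
  (by fun_prop : Measurable fun t : ℝ => (1 - t ^ 2) ^ (c - 1)).indicator measurableSet_Iio

lemma integral_semicircleWeight_mul_pow {c : ℝ} (hc : 0 < c) (j : ℕ) :
    ∫ t in Set.Ioi (0:ℝ), semicircleWeight c t * t ^ (2 * j) =
      Real.Gamma (j + 1 / 2) * Real.Gamma c / Real.Gamma (j + 1 / 2 + c) / 2 := by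
  have hj : (0:ℝ) < j + 1 / 2 := by positivity
  rw [← integral_beta hj hc, intervalIntegral.integral_of_le zero_le_one, integral_Ioc_eq_integral_Ioo]
  have := integral_comp_rpow_Ioi_of_pos (p := 2)
    (g := (Set.Iio (1:ℝ)).indicator fun x : ℝ => x ^ ((j:ℝ) + 1 / 2 - 1) * (1 - x) ^ (c - 1))
    two_pos
  rw [setIntegral_indicator measurableSet_Iio, Set.Ioi_inter_Iio] at this
  rw [← this, eq_div_iff two_ne_zero, ← integral_mul_const]
  refine setIntegral_congr_fun measurableSet_Ioi fun t (ht : 0 < t) => ?_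
  simp only [semicircleWeight, Set.indicator, Set.mem_Iio, smul_eq_mul]
  have e : t ^ (2:ℝ) = t ^ 2 := Real.rpow_two t
  by_cases h : t < 1
  · rw [if_pos h, if_pos (by rw [e]; nlinarith), e, ← e, ← Real.rpow_mul ht.le, e]
    have : t ^ ((2:ℝ) - 1) * t ^ (2 * ((j:ℝ) + 1 / 2 - 1)) = t ^ (2 * j) := by
      rw [← Real.rpow_add ht, ← Real.rpow_natCast]
      congr 1; push_cast; ring
    rw [← this]; ring
  · rw [if_neg h, if_neg (by rw [e]; nlinarith)]; simp

lemma integrableOn_semicircleWeight {c : ℝ} (hc : 0 < c) :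
    IntegrableOn (semicircleWeight c) (Set.Ioi (0:ℝ)) := by
  have := integral_semicircleWeight_mul_pow hc 0
  simp only [mul_zero, pow_zero, mul_one, Nat.cast_zero, zero_add] at this
  refine not_not.1 fun h => ?_
  rw [integral_undef h] at this
  have h1 := Real.Gamma_pos_of_pos (one_half_pos (α := ℝ))
  have h2 := Real.Gamma_pos_of_pos hc
  have h3 : 0 < Real.Gamma (1 / 2 + c) := Real.Gamma_pos_of_pos (by positivity)
  have : 0 < Real.Gamma (1 / 2) * Real.Gamma c / Real.Gamma (1 / 2 + c) / 2 := by positivity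
  linarith

/-- The normalized modified Bessel function `∑ (z²/4)^j / (j! Γ(a + j))`. -/
def hypH (a z : ℝ) : ℝ := ∑' j : ℕ, (z ^ 2 / 4) ^ j / (Nat.factorial j * Real.Gamma (a + j))

lemma factorial_two_mul_eq_Gamma (j : ℕ) :
    ((Nat.factorial (2 * j) : ℕ) : ℝ) * √Real.pi =
      4 ^ j * Real.Gamma (j + 1 / 2) * Nat.factorial j := by
  have h := Real.Gamma_mul_Gamma_add_half ((j:ℝ) + 1 / 2)
  rw [show (j:ℝ) + 1 / 2 + 1 / 2 = j + 1 by ring, Real.Gamma_nat_eq_factorial,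
    show 2 * ((j:ℝ) + 1 / 2) = ((2 * j : ℕ) : ℝ) + 1 by push_cast; ring,
    Real.Gamma_nat_eq_factorial] at h
  rw [mul_assoc, h, show 1 - (((2 * j : ℕ) : ℝ) + 1) = -((2 * j : ℕ) : ℝ) by ring,
    Real.rpow_neg two_pos.le, Real.rpow_natCast, pow_mul]
  norm_num
  field_simp

lemma hasSum_hypH_half (z : ℝ) :
    HasSum (fun j : ℕ => (z ^ 2 / 4) ^ j / (Nat.factorial j * Real.Gamma (1 / 2 + j)))
      (Real.cosh z / √Real.pi) := by
  refine ((Real.hasSum_cosh z).div_const _).congr_fun fun j => ?_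
  rw [div_div, factorial_two_mul_eq_Gamma, pow_mul, div_pow, add_comm (1 / 2 : ℝ)]
  have : 0 < Real.Gamma (j + 1 / 2) := Real.Gamma_pos_of_pos (by positivity)
  field_simp

lemma hasSum_hypH_of_pos {c : ℝ} (hc : 0 < c) (z : ℝ) :
    HasSum (fun j : ℕ => (z ^ 2 / 4) ^ j / (Nat.factorial j * Real.Gamma (c + 1 / 2 + j)))
      (2 / (√Real.pi * Real.Gamma c) *
        ∫ t in Set.Ioi (0:ℝ), semicircleWeight c t * Real.cosh (z * t)) := by
  have hI := integrableOn_semicircleWeight hc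
  have key : HasSum (fun j : ℕ => ∫ t in Set.Ioi (0:ℝ),
      semicircleWeight c t * ((z * t) ^ (2 * j) / (Nat.factorial (2 * j))))
      (∫ t in Set.Ioi (0:ℝ), semicircleWeight c t * Real.cosh (z * t)) := by
    refine hasSum_integral_of_dominated_convergence
      (fun j t => semicircleWeight c t * (z ^ (2 * j) / (Nat.factorial (2 * j))))
      (fun j => ?_) (fun j => ?_) ?_ ?_ ?_
    · have := measurable_semicircleWeight c
      fun_prop
    · filter_upwards [self_mem_ae_restrict measurableSet_Ioi] with t (ht : 0 < t)
      have h0 := semicircleWeight_nonneg (c := c) ht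
      rw [norm_mul, Real.norm_of_nonneg h0]
      by_cases h : t < 1
      · refine mul_le_mul_of_nonneg_left ?_ h0
        rw [pow_mul, pow_mul, Real.norm_of_nonneg (by positivity)]
        have h1 : (z * t) ^ 2 ≤ z ^ 2 := by
          rw [mul_pow]
          have : t ^ 2 ≤ 1 := by nlinarith
          nlinarith [sq_nonneg z]
        have := pow_le_pow_left₀ (sq_nonneg _) h1 j
        gcongr
      · simp [semicircleWeight, h]
    · refine ae_of_all _ fun t => ((Real.hasSum_cosh z).mul_left _).summable
    · simp_rw [fun t => ((Real.hasSum_cosh z).mul_left (semicircleWeight c t)).tsum_eq]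
      exact hI.mul_const _
    · exact ae_of_all _ fun t => (Real.hasSum_cosh (z * t)).mul_left _
  refine (key.mul_left _).congr_fun fun j => ?_
  have e : ∀ t : ℝ, semicircleWeight c t * ((z * t) ^ (2 * j) / (Nat.factorial (2 * j))) =
      (semicircleWeight c t * t ^ (2 * j)) * (z ^ (2 * j) / (Nat.factorial (2 * j))) := by
    intro t; rw [mul_pow]; ring
  simp_rw [e]
  rw [integral_mul_const, integral_semicircleWeight_mul_pow hc, pow_mul, div_pow]
  have h1 : 0 < Real.Gamma (j + 1 / 2) := Real.Gamma_pos_of_pos (by positivity)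
  have h2 : 0 < Real.Gamma (j + 1 / 2 + c) := Real.Gamma_pos_of_pos (by positivity)
  have h3 := Real.Gamma_pos_of_pos hc
  have h4 := factorial_two_mul_eq_Gamma j
  have h5 : 0 < √Real.pi := by positivity
  have h6 : (0:ℝ) < Nat.factorial (2 * j) := by positivity
  rw [show c + 1 / 2 + (j:ℝ) = j + 1 / 2 + c by ring]
  generalize Real.Gamma (j + 1 / 2) = G at *
  generalize Real.Gamma (j + 1 / 2 + c) = G' at *
  field_simp
  linear_combination (z ^ 2) ^ j * h4


lemma integral_semicircleWeight_mul_cosh {c : ℝ} (z : ℝ) :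
    ∫ t in Set.Ioi (0:ℝ), semicircleWeight c t * Real.cosh (z * t) =
      ∫ v in Set.Ioi (0:ℝ), v ^ (c - 1) *
        ((Set.Iio (1:ℝ)).indicator (fun v => (2 - v) ^ (c - 1)) v * Real.cosh (z * (1 - v))) := by
  have h1 : ∀ f : ℝ → ℝ, ∫ t in Set.Ioi (0:ℝ), (Set.Iio (1:ℝ)).indicator f t =
      ∫ t in (0:ℝ)..1, f t := by
    intro f
    rw [setIntegral_indicator measurableSet_Iio, Set.Ioi_inter_Iio,
      intervalIntegral.integral_of_le zero_le_one, integral_Ioc_eq_integral_Ioo]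
  have e1 : ∀ t, semicircleWeight c t * Real.cosh (z * t) =
      (Set.Iio (1:ℝ)).indicator (fun t => (1 - t ^ 2) ^ (c - 1) * Real.cosh (z * t)) t := by
    intro t
    by_cases h : t < 1 <;> simp [semicircleWeight, h]
  have e2 : ∀ v : ℝ, v ^ (c - 1) *
        ((Set.Iio (1:ℝ)).indicator (fun v => (2 - v) ^ (c - 1)) v * Real.cosh (z * (1 - v))) =
      (Set.Iio (1:ℝ)).indicator (fun v => v ^ (c - 1) * (2 - v) ^ (c - 1) *
        Real.cosh (z * (1 - v))) v := by
    intro t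
    by_cases h : t < 1 <;> simp [h, mul_assoc]
  simp_rw [e1, e2]
  rw [h1, h1]
  have := intervalIntegral.integral_comp_sub_left (a := 0) (b := 1)
    (fun t => (1 - t ^ 2) ^ (c - 1) * Real.cosh (z * t)) 1
  simp only [sub_self, sub_zero] at this
  rw [← this]
  refine intervalIntegral.integral_congr fun v hv => ?_
  rw [Set.uIcc_of_le zero_le_one] at hv
  rw [← Real.mul_rpow hv.1 (by linarith [hv.2])]
  congr 2
  ring

lemma isBigO_rpow_mul_exp_neg (c : ℝ) (N : ℕ) :
    (fun z : ℝ => z ^ c * Real.exp (-z)) =O[atTop] fun z => z⁻¹ ^ N := by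
  have h := (isLittleO_exp_neg_mul_rpow_atTop (a := 1) one_pos (-(c + N))).isBigO
  refine ((isBigO_refl (fun z : ℝ => z ^ c) atTop).mul h).congr' ?_ ?_
  · filter_upwards with z; simp
  · filter_upwards [eventually_gt_atTop 0] with z hz
    rw [← Real.rpow_add hz, show c + -(c + N) = -(N:ℝ) by ring, Real.rpow_neg hz.le,
      Real.rpow_natCast, inv_pow]

lemma AsympExp.zero_of_isBigO {f : ℝ → ℝ} (h : ∀ N : ℕ, f =O[atTop] fun z => z⁻¹ ^ N) :
    AsympExp f 0 := fun N => by simpa using h N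

lemma AsympExp.add {f g : ℝ → ℝ} {c d : ℕ → ℝ} (hf : AsympExp f c) (hg : AsympExp g d) :
    AsympExp (fun t => f t + g t) (fun k => c k + d k) := fun N => by
  refine ((hf N).add (hg N)).congr_left fun t => ?_
  simp only [add_mul, Finset.sum_add_distrib]; ring

lemma genBinom_mul_neg_pow (c x : ℝ) (k : ℕ) :
    genBinom c k * (-x) ^ k = poch (-c) k * x ^ k / Nat.factorial k := by
  have : (∏ t ∈ range k, (c - t)) * (-1) ^ k = ∏ t ∈ range k, (-c + t) := by
    rw [← Finset.card_range k, ← Finset.prod_const, Finset.card_range, ← Finset.prod_mul_distrib]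
    exact Finset.prod_congr rfl fun _ _ => by ring
  rw [genBinom, poch, ← this, neg_pow]
  ring

lemma Gamma_add_nat {c : ℝ} (hc : 0 < c) (k : ℕ) :
    Real.Gamma (c + k) = poch c k * Real.Gamma c := by
  induction k with
  | zero => simp [poch]
  | succ k ih =>
    have : 0 < c + k := by positivity
    rw [Nat.cast_succ, ← add_assoc, Real.Gamma_add_one this.ne', ih, poch, poch,
      Finset.prod_range_succ]
    ring

/-- Local expansion of the weight appearing after the substitution `t = 1 - v`. -/
lemma weight_expansion (c : ℝ) (N : ℕ) : ∃ C, ∀ v, 0 < v →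
    |(Set.Iio (1:ℝ)).indicator (fun v => (2 - v) ^ c) v -
      ∑ k ∈ range N, 2 ^ c * (genBinom c k * (-(1/2)) ^ k) * v ^ k| ≤ C * v ^ N := by
  set S : ℝ → ℝ := fun v => ∑ k ∈ range N, 2 ^ c * (genBinom c k * (-(1/2)) ^ k) * v ^ k
  have h0 : (fun v => (Set.Iio (1:ℝ)).indicator (fun v => (2 - v) ^ c) v - S v) =O[𝓝[>] 0]
      fun v => v ^ N := by
    have ht : Tendsto (fun v : ℝ => -(1/2) * v) (𝓝[>] 0) (𝓝 0) := by
      have : Tendsto (fun v : ℝ => -(1/2) * v) (𝓝 0) (𝓝 (-(1/2) * 0)) :=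
        (continuous_const.mul continuous_id).tendsto 0
      rw [mul_zero] at this
      exact this.mono_left nhdsWithin_le_nhds
    have h1 := ((isBigO_one_add_rpow_sub c N).comp_tendsto ht).const_mul_left (2 ^ c)
    refine (h1.congr' ?_ EventuallyEq.rfl).trans ?_
    · filter_upwards [Ioo_mem_nhdsGT (zero_lt_one (α := ℝ))] with v hv
      rw [Set.indicator_of_mem (by exact hv.2)]
      simp only [Function.comp, S, mul_sub, Finset.mul_sum]
      congr 1
      · rw [← Real.mul_rpow two_pos.le (by linarith [hv.2])]
        congr 1; ring
      · exact Finset.sum_congr rfl fun k _ => by rw [mul_pow]; ring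
    · simp only [Function.comp_def, mul_pow]
      exact (isBigO_refl _ _).const_mul_left _
  have h2 : ∀ v, 0 < v → |(Set.Iio (1:ℝ)).indicator (fun v => (2 - v) ^ c) v - S v| ≤
      (2 ^ |c| + ∑ k ∈ range N, |2 ^ c * (genBinom c k * (-(1/2)) ^ k)|) *
        ((1 + v) ^ N * (1 + v) ^ 0) := by
    intro v hv
    rw [pow_zero, mul_one, add_mul, Finset.sum_mul]
    refine (abs_sub _ _).trans (add_le_add ?_ ((Finset.abs_sum_le_sum_abs _ _).trans
      (Finset.sum_le_sum fun k hk => ?_)))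
    · have h1 : 1 ≤ (1 + v) ^ N := one_le_pow₀ (by linarith)
      refine le_trans ?_ (le_mul_of_one_le_right (by positivity) h1)
      by_cases h : v < 1
      · rw [Set.indicator_of_mem (by exact h), abs_of_nonneg (Real.rpow_nonneg (by linarith) _)]
        refine (Real.rpow_le_rpow_of_exponent_le (by linarith) (le_abs_self c)).trans ?_
        exact Real.rpow_le_rpow (by linarith) (by linarith) (abs_nonneg c)
      · rw [Set.indicator_of_notMem (by exact h), abs_zero]; positivity
    · rw [abs_mul, abs_of_pos (pow_pos hv k)]
      gcongr
      calc v ^ k ≤ (1 + v) ^ k := by gcongr; linarith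
        _ ≤ (1 + v) ^ N := pow_le_pow_right₀ (by linarith) (by simp at hk; omega)
  obtain ⟨C', -, hC'⟩ := exists_bound_of_isBigO h0 h2
  exact ⟨C', fun v hv => by simpa only [pow_zero, mul_one] using hC' v hv⟩

/-- Large argument expansion of the normalized modified Bessel function. -/
lemma asympExp_hypH {c : ℝ} (hc : 0 < c) :
    AsympExp (fun z => z ^ c * Real.exp (-z) * hypH (c + 1 / 2) z)
      (fun k => 2 ^ (c - 1) / √Real.pi *
        (poch (1 - c) k * poch c k / (Nat.factorial k * 2 ^ k))) := by
  set g : ℝ → ℝ := (Set.Iio (1:ℝ)).indicator (fun v => (2 - v) ^ (c - 1)) with hg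
  have hgm : Measurable g :=
    (by fun_prop : Measurable fun v : ℝ => (2 - v) ^ (c - 1)).indicator measurableSet_Iio
  have hw := asympExp_laplace hc hgm (weight_expansion (c - 1))
  obtain ⟨C, hC⟩ := weight_expansion (c - 1) 0
  have hC : ∀ v, 0 < v → |g v| ≤ C := by simpa using hC
  have hE : ∀ N : ℕ, (fun z : ℝ => z ^ c * ∫ v in Set.Ioi (0:ℝ),
      v ^ (c - 1) * (g v * Real.exp (-(z * 2) + z * v))) =O[atTop] fun z => z⁻¹ ^ N := by
    intro N
    have hI : IntegrableOn (fun v => v ^ (c - 1) * |g v|) (Set.Ioi (0:ℝ)) := by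
      have h1 := (integrableOn_rpow_mul_exp_neg_mul hc one_pos 0).mul_const (C * Real.exp 1)
      refine h1.mono' (by fun_prop) ?_
      filter_upwards [self_mem_ae_restrict measurableSet_Ioi] with v (hv : 0 < v)
      rw [Real.norm_of_nonneg (by positivity), pow_zero, mul_one, mul_assoc]
      by_cases h : v < 1
      · refine mul_le_mul_of_nonneg_left ?_ (by positivity)
        calc |g v| ≤ C * 1 := by simpa using hC v hv
          _ ≤ C * Real.exp (-(1 * v) + 1) := by
            gcongr
            · exact (abs_nonneg _).trans (hC v hv)
            · exact Real.one_le_exp (by linarith)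
          _ = _ := by rw [Real.exp_add]; ring
      · have : g v = 0 := by simp [hg, h]
        have hC0 := (abs_nonneg _).trans (hC v hv)
        rw [this, abs_zero, mul_zero]; positivity
    refine IsBigO.trans (IsBigO.of_bound (∫ v in Set.Ioi (0:ℝ), v ^ (c - 1) * |g v|) ?_)
      (isBigO_rpow_mul_exp_neg c N)
    filter_upwards [eventually_gt_atTop 0] with z hz
    rw [norm_mul, norm_mul, mul_comm, mul_left_comm]
    rw [mul_comm]
    refine mul_le_mul_of_nonneg_left ?_ (norm_nonneg _)
    rw [← integral_mul_const]
    refine norm_integral_le_of_norm_le (hI.mul_const _) ?_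
    filter_upwards [self_mem_ae_restrict measurableSet_Ioi] with v (hv : 0 < v)
    rw [norm_mul, norm_mul, Real.norm_of_nonneg (by positivity : 0 ≤ v ^ (c-1)), Real.norm_eq_abs,
      Real.norm_of_nonneg (Real.exp_pos _).le, Real.norm_of_nonneg (Real.exp_pos _).le, mul_assoc]
    by_cases h : v < 1
    · gcongr; nlinarith
    · have : g v = 0 := by simp [hg, h]
      simp [this]
  have hsum := ((hw.add (AsympExp.zero_of_isBigO hE)).const_mul
    (1 / (√Real.pi * Real.Gamma c)))
  refine (hsum.congr' ?_).congr_coeff fun k => ?_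
  · filter_upwards [eventually_gt_atTop 0] with z hz
    rw [hypH, (hasSum_hypH_of_pos hc z).tsum_eq, integral_semicircleWeight_mul_cosh]
    rw [← mul_add, ← integral_add]
    · have e : ∀ v : ℝ, v ^ (c - 1) * Real.exp (-(z * v)) * g v +
          v ^ (c - 1) * (g v * Real.exp (-(z * 2) + z * v)) =
          v ^ (c - 1) * (g v * Real.cosh (z * (1 - v))) * (2 * Real.exp (-z)) := by
        intro v
        rw [Real.cosh_eq, show -(z * v) = z * (1 - v) + -z by ring,
          show -(z * 2) + z * v = -(z * (1 - v)) + -z by ring, Real.exp_add, Real.exp_add]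
        ring
      simp_rw [e]
      rw [integral_mul_const]
      ring
    · have := (integrableOn_rpow_mul_exp_neg_mul hc hz 0).mul_const C
      refine this.mono' (by fun_prop) ?_
      filter_upwards [self_mem_ae_restrict measurableSet_Ioi] with v (hv : 0 < v)
      rw [norm_mul, Real.norm_of_nonneg (by positivity), pow_zero, mul_one]
      gcongr
      exact hC v hv
    · have := ((integrableOn_rpow_mul_exp_neg_mul hc hz 0).mul_const C)
      refine this.mono' (by fun_prop) ?_
      filter_upwards [self_mem_ae_restrict measurableSet_Ioi] with v (hv : 0 < v)
      have hC0 := (abs_nonneg _).trans (hC v hv)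
      rw [norm_mul, norm_mul, Real.norm_of_nonneg (by positivity : 0 ≤ v ^ (c-1)),
        Real.norm_eq_abs, Real.norm_of_nonneg (Real.exp_pos _).le, pow_zero, mul_one, mul_assoc]
      refine mul_le_mul_of_nonneg_left ?_ (by positivity)
      by_cases h : v < 1
      · rw [mul_comm]
        gcongr
        · nlinarith
        · exact hC v hv
      · have : g v = 0 := by simp [hg, h]
        rw [this, abs_zero, zero_mul]; positivity
  · simp only [Pi.zero_apply, add_zero]
    rw [genBinom_mul_neg_pow, Gamma_add_nat hc, neg_sub, div_pow, one_pow]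
    have := Real.Gamma_pos_of_pos hc
    field_simp

lemma asympExp_hypH_zero :
    AsympExp (fun z => z ^ (0:ℝ) * Real.exp (-z) * hypH (0 + 1 / 2) z)
      (fun k => 2 ^ ((0:ℝ) - 1) / √Real.pi *
        (poch (1 - 0) k * poch 0 k / (Nat.factorial k * 2 ^ k))) := by
  have h1 : AsympExp (fun z => 1 / (2 * √Real.pi) * (z ^ (0:ℝ) * Real.exp (-(2 * z))))
      (fun k => 1 / (2 * √Real.pi) * (0 : ℕ → ℝ) k) := by
    refine (AsympExp.zero_of_isBigO fun N => ?_).const_mul _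
    have h := (isBigO_rpow_mul_exp_neg 0 N)
    refine IsBigO.trans (IsBigO.of_bound 1 ?_) h
    filter_upwards [eventually_gt_atTop 0] with z hz
    rw [one_mul, Real.rpow_zero, one_mul, one_mul, Real.norm_of_nonneg (Real.exp_pos _).le,
      Real.norm_of_nonneg (Real.exp_pos _).le]
    gcongr; linarith
  refine (((asympExp_const (1 / (2 * √Real.pi))).add h1).congr' ?_).congr_coeff fun k => ?_
  · filter_upwards with z
    rw [zero_add, hypH, (hasSum_hypH_half z).tsum_eq, Real.cosh_eq, Real.rpow_zero,
      show -(2 * z) = -z + -z by ring, Real.exp_add]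
    have : Real.exp (-z) * Real.exp z = 1 := by rw [← Real.exp_add]; simp
    field_simp
    linear_combination -this
  · rcases k with _ | k
    · simp [poch, Real.rpow_neg_one]; ring
    · simp [poch_succ']

/-- Large argument expansion of the normalized modified Bessel function, index `n / 2`. -/
lemma asympExp_hypH_nat {n : ℕ} (hn : 1 ≤ n) :
    AsympExp (fun z => z ^ (((n:ℝ) - 1) / 2) * Real.exp (-z) * hypH (n / 2) z)
      (fun k => 2 ^ ((n:ℝ) / 2 - 3 / 2) / √Real.pi *
        (poch ((3 - (n:ℝ)) / 2) k * poch (((n:ℝ) - 1) / 2) k / (Nat.factorial k * 2 ^ k))) := by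
  have e1 : (n:ℝ) / 2 = ((n:ℝ) - 1) / 2 + 1 / 2 := by ring
  have e2 : (n:ℝ) / 2 - 3 / 2 = ((n:ℝ) - 1) / 2 - 1 := by ring
  have e3 : (3 - (n:ℝ)) / 2 = 1 - ((n:ℝ) - 1) / 2 := by ring
  rw [e2, e3]
  conv in hypH _ _ => rw [e1]
  rcases hn.lt_or_eq with h | h
  · have : (1:ℝ) < n := by exact_mod_cast h
    exact asympExp_hypH (by linarith)
  · subst h
    simpa using asympExp_hypH_zero

lemma sum_antidiagonalTuple_succ_prod (f : ℕ → ℝ) (m N : ℕ) :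
    ∑ r ∈ Finset.Nat.antidiagonalTuple (m + 1) N, ∏ t, f (r t) =
      ∑ k ∈ range (N + 1), f k * ∑ r ∈ Finset.Nat.antidiagonalTuple m (N - k), ∏ t, f (r t) := by
  simp_rw [Finset.mul_sum]
  rw [Finset.sum_sigma']
  refine Finset.sum_bij' (fun r _ => ⟨r 0, fun t => r t.succ⟩) (fun x _ => Fin.cons x.1 x.2)
    ?_ ?_ ?_ ?_ ?_
  · intro r hr
    rw [Finset.Nat.mem_antidiagonalTuple, Fin.sum_univ_succ] at hr
    simp only [Finset.mem_sigma, Finset.mem_range, Finset.Nat.mem_antidiagonalTuple]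
    omega
  · rintro ⟨k, x⟩ hx
    simp only [Finset.mem_sigma, Finset.mem_range, Finset.Nat.mem_antidiagonalTuple] at hx
    rw [Finset.Nat.mem_antidiagonalTuple, Fin.sum_univ_succ]
    simp only [Fin.cons_zero, Fin.cons_succ]
    omega
  · intro r _
    exact Fin.cons_self_tail r
  · rintro ⟨k, x⟩ _
    simp
  · intro r _
    rw [Fin.prod_univ_succ]

lemma compS_zero (q : ℕ) : compS q 0 = if q = 0 then 1 else 0 := by
  rcases q with _ | q <;> simp [compS]

lemma compS_of_lt {q m : ℕ} (h : q < m) : compS q m = 0 := by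
  rw [compS, if_neg (by omega)]

lemma compS_succ (q m : ℕ) :
    compS q (m + 1) =
      ∑ k ∈ range (q + 1), (if k = 0 then 0 else genBinom (1 / 2) k) * compS (q - k) m := by
  rw [Finset.sum_range_succ', if_pos rfl, zero_mul, add_zero]
  simp only [Nat.add_eq_zero_iff, one_ne_zero, and_false, if_false]
  by_cases h : m + 1 ≤ q
  · rw [compS, if_pos h, sum_antidiagonalTuple_succ_prod (fun k => genBinom (1 / 2) (1 + k)),
      show q - (m + 1) + 1 = q - m by omega]
    symm
    rw [← Finset.sum_subset (Finset.range_subset_range.2 (Nat.sub_le q m))]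
    · refine Finset.sum_congr rfl fun k hk => ?_
      rw [mem_range] at hk
      rw [compS, if_pos (by omega), add_comm 1 k, show q - (k + 1) - m = q - (m + 1) - k by omega]
    · intro k hk' hk
      rw [mem_range] at hk hk'
      rw [compS_of_lt (by omega), mul_zero]
  · rw [compS_of_lt (by omega)]
    refine (Finset.sum_eq_zero fun k hk => ?_).symm
    rw [mem_range] at hk
    rw [compS_of_lt (by omega), mul_zero]

/-- The Taylor coefficients at `0` of `(√(1 + w) - 1) ^ m * (1 + w) ^ α`. -/
def sqrtCoef (α : ℝ) (m i : ℕ) : ℝ := ∑ p ∈ range (i + 1), genBinom α p * compS (i - p) m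

lemma sqrtCoef_of_lt {α : ℝ} {m i : ℕ} (h : i < m) : sqrtCoef α m i = 0 :=
  Finset.sum_eq_zero fun p _ => by rw [compS_of_lt (by omega), mul_zero]

lemma asympExp_sqrt_sub_one_pow (m : ℕ) :
    AsympExp (fun t => (√(1 + t⁻¹) - 1) ^ m) (fun q => compS q m) := by
  induction m with
  | zero => simpa [compS_zero] using asympExp_const 1
  | succ m ih =>
    have h1 : AsympExp (fun t => √(1 + t⁻¹) - 1)
        (fun k => if k = 0 then 0 else genBinom (1 / 2) k) := by
      refine (((asympExp_one_add_div_rpow (1 / 2) 1).add (asympExp_const (-1))).congr' ?_).congr_coeff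
        fun k => ?_
      · filter_upwards with t
        rw [Real.sqrt_eq_rpow, one_div t, sub_eq_add_neg]
      · rcases k with _ | k <;> simp [genBinom]
    refine ((h1.mul ih).congr' ?_).congr_coeff fun q => (compS_succ q m).symm
    filter_upwards with t
    ring

lemma asympExp_sqrtCoef (α : ℝ) (m : ℕ) :
    AsympExp (fun t => (√(1 + t⁻¹) - 1) ^ m * (1 + t⁻¹) ^ α) (sqrtCoef α m) := by
  have h := (asympExp_one_add_div_rpow α 1).mul (asympExp_sqrt_sub_one_pow m)
  refine (h.congr' ?_).congr_coeff fun q => ?_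
  · filter_upwards with t
    rw [one_div, mul_comm]
  · simp [sqrtCoef]

lemma sqrt_one_add_rpow_bound (α : ℝ) (m N : ℕ) : ∃ (C : ℝ) (M : ℕ), 0 ≤ C ∧ ∀ w : ℝ, 0 < w →
    |(√(1 + w) - 1) ^ m * (1 + w) ^ α - ∑ i ∈ range N, sqrtCoef α m i * w ^ i| ≤
      C * (w ^ N * (1 + w) ^ M) := by
  set K := m + ⌈|α|⌉₊
  have h0 : (fun w : ℝ => (√(1 + w) - 1) ^ m * (1 + w) ^ α - ∑ i ∈ range N, sqrtCoef α m i * w ^ i)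
      =O[𝓝[>] 0] fun w => w ^ N := by
    refine ((asympExp_sqrtCoef α m N).comp_tendsto tendsto_inv_nhdsGT_zero).congr ?_ ?_ <;>
    · intro w; simp [Function.comp]
  obtain ⟨C, hC, h⟩ := exists_bound_of_isBigO (M := K) h0
    (C := 1 + ∑ i ∈ range N, |sqrtCoef α m i|) fun w hw => by
      have hw1 : 1 ≤ 1 + w := by linarith
      have hs : 1 ≤ √(1 + w) := Real.one_le_sqrt.2 hw1
      have hs2 : √(1 + w) ≤ 1 + w := Real.sqrt_le_iff.2 ⟨by linarith, by nlinarith⟩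
      have hN : 1 ≤ (1 + w) ^ N := one_le_pow₀ hw1
      have hK : 1 ≤ (1 + w) ^ K := one_le_pow₀ hw1
      rw [add_mul, one_mul, Finset.sum_mul]
      refine (abs_sub _ _).trans (add_le_add ?_ ((Finset.abs_sum_le_sum_abs _ _).trans
        (Finset.sum_le_sum fun k hk => ?_)))
      · rw [abs_mul, abs_of_nonneg (pow_nonneg (by linarith) _),
          abs_of_pos (Real.rpow_pos_of_pos (by linarith) _)]
        refine le_trans ?_ (le_mul_of_one_le_left (by positivity) hN)
        rw [pow_add]
        refine mul_le_mul (pow_le_pow_left₀ (by linarith) (by linarith) _) ?_ (by positivity)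
          (by positivity)
        rw [← Real.rpow_natCast]
        exact Real.rpow_le_rpow_of_exponent_le hw1 ((le_abs_self α).trans (Nat.le_ceil _))
      · rw [abs_mul, abs_of_pos (pow_pos hw k)]
        refine mul_le_mul_of_nonneg_left ?_ (abs_nonneg _)
        refine le_trans ?_ (le_mul_of_one_le_right (by positivity) hK)
        calc w ^ k ≤ (1 + w) ^ k := by gcongr; linarith
          _ ≤ (1 + w) ^ N := pow_le_pow_right₀ (by linarith) (by simp at hk; omega)
  exact ⟨C, K, hC, h⟩

section Averages

variable {ν : Measure ℝ}

/-- Expansion of an average of `h (b / u)` over `b` distributed along `ν`. -/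
lemma asympExp_integral_div (hν : ∀ᵐ b ∂ν, 0 < b)
    (hm : ∀ M : ℕ, Integrable (fun b => (1 + b) ^ M) ν) {h : ℝ → ℝ} {e : ℕ → ℝ}
    (hh : Measurable h)
    (hb : ∀ N : ℕ, ∃ (C : ℝ) (M : ℕ), 0 ≤ C ∧ ∀ w, 0 < w →
      |h w - ∑ i ∈ range N, e i * w ^ i| ≤ C * (w ^ N * (1 + w) ^ M)) :
    AsympExp (fun u => ∫ b, h (b / u) ∂ν) (fun i => e i * ∫ b, b ^ i ∂ν) := by
  have hpow : ∀ i : ℕ, Integrable (fun b : ℝ => b ^ i) ν := fun i => by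
    refine (hm i).mono' (by fun_prop) ?_
    filter_upwards [hν] with b hb
    rw [Real.norm_of_nonneg (by positivity)]
    gcongr; linarith
  have key : ∀ N : ℕ, ∃ (C : ℝ) (M : ℕ), 0 ≤ C ∧ ∀ u, 1 ≤ u → ∀ b, 0 < b →
      |h (b / u) - ∑ i ∈ range N, e i * (b / u) ^ i| ≤ C * u⁻¹ ^ N * (1 + b) ^ M := by
    intro N
    obtain ⟨C, M, hC, hM⟩ := hb N
    refine ⟨C, N + M, hC, fun u hu b hb => (hM _ (by positivity)).trans ?_⟩
    have h1 : b / u ≤ b := div_le_self hb.le hu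
    rw [pow_add]
    calc C * ((b / u) ^ N * (1 + b / u) ^ M) = C * u⁻¹ ^ N * (b ^ N * (1 + b / u) ^ M) := by
          rw [div_eq_mul_inv, mul_pow]; ring
      _ ≤ _ := by gcongr; linarith
  intro N
  obtain ⟨C, M, hC, hM⟩ := key N
  obtain ⟨C₀, M₀, hC₀, hM₀⟩ := key 0
  refine IsBigO.of_bound (C * ∫ b, (1 + b) ^ M ∂ν) ?_
  filter_upwards [eventually_ge_atTop 1] with u hu
  have hI : Integrable (fun b => h (b / u)) ν := by
    refine ((hm M₀).const_mul C₀).mono' (hh.comp (by fun_prop)).aestronglyMeasurable ?_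
    filter_upwards [hν] with b hb
    simpa using hM₀ u hu b hb
  have e1 : (∫ b, h (b / u) ∂ν) - ∑ i ∈ range N, e i * (∫ b, b ^ i ∂ν) * u⁻¹ ^ i =
      ∫ b, (h (b / u) - ∑ i ∈ range N, e i * (b / u) ^ i) ∂ν := by
    have hi : ∀ i ∈ range N, Integrable (fun b : ℝ => e i * (b / u) ^ i) ν := fun i _ => by
      simp only [div_eq_mul_inv, mul_pow]
      exact ((hpow i).mul_const _).const_mul _
    rw [integral_sub hI (integrable_finsetSum _ hi), integral_finsetSum _ hi]
    congr 1
    refine Finset.sum_congr rfl fun i _ => ?_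
    simp only [div_eq_mul_inv, mul_pow]
    rw [integral_const_mul, integral_mul_const]; ring
  rw [e1, norm_pow, Real.norm_of_nonneg (by positivity : 0 ≤ u⁻¹)]
  calc _ ≤ ∫ b, C * u⁻¹ ^ N * (1 + b) ^ M ∂ν := by
        refine norm_integral_le_of_norm_le ((hm M).const_mul _) ?_
        filter_upwards [hν] with b hb using hM u hu b hb
    _ = _ := by rw [integral_const_mul]; ring

end Averages

/-- The expansion of `t ^ m * g (t ^ 2)` when that of `g` starts at order `m`. -/
lemma AsympExp.comp_sq {g : ℝ → ℝ} {e : ℕ → ℝ} (h : AsympExp g e) {m : ℕ}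
    (he : ∀ i < m, e i = 0) :
    AsympExp (fun t => t ^ m * g (t ^ 2))
      (fun p => if 2 ∣ p + m then e ((p + m) / 2) else 0) := by
  refine AsympExp.of_large fun N => ?_
  have hs : ∀ d : ℕ, ∀ t : ℝ, t ≠ 0 → ∑ p ∈ range (m + 2 * d),
      (if 2 ∣ p + m then e ((p + m) / 2) else 0) * t⁻¹ ^ p =
      t ^ m * ∑ i ∈ range (m + d), e i * (t ^ 2)⁻¹ ^ i := by
    intro d t ht
    induction d with
    | zero =>
      rw [mul_zero, add_zero, Finset.sum_eq_zero, Finset.sum_eq_zero, mul_zero]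
      · intro i hi; rw [he i (mem_range.1 hi), zero_mul]
      · intro p hp
        rw [mem_range] at hp
        rw [he _ (by omega)]; simp
    | succ d ih =>
      rw [show m + 2 * (d + 1) = m + 2 * d + 1 + 1 by ring, Finset.sum_range_succ,
        Finset.sum_range_succ, ih, ← add_assoc m d 1, Finset.sum_range_succ,
        if_pos (by omega), if_neg (by omega), show (m + 2 * d + m) / 2 = m + d by omega]
      have : t⁻¹ ^ (m + 2 * d) = t ^ m * (t ^ 2)⁻¹ ^ (m + d) := by
        simp only [inv_pow, ← pow_mul]
        field_simp
        rw [← pow_add]; congr 1; ring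
      rw [this]; ring
  refine ⟨m + 2 * N, by omega, ?_⟩
  have h1 := (h (m + N)).comp_tendsto (tendsto_pow_atTop (two_ne_zero) : Tendsto (fun t : ℝ => t ^ 2) atTop atTop)
  have h2 := (isBigO_refl (fun t : ℝ => t ^ m) atTop).mul h1
  refine (h2.congr' ?_ ?_).trans (isBigO_inv_pow_of_le (show N ≤ m + 2 * N by omega))
  · filter_upwards [eventually_ne_atTop 0] with t ht
    simp only [Function.comp, mul_sub]
    rw [hs N t ht]
  · filter_upwards [eventually_ne_atTop 0] with t ht
    simp only [Function.comp, inv_pow, ← pow_mul]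
    field_simp
    rw [← pow_add]; congr 1; ring

lemma exp_sub_sum_le {x : ℝ} (hx : 0 ≤ x) (N : ℕ) :
    |Real.exp x - ∑ m ∈ range N, x ^ m / Nat.factorial m| ≤ x ^ N * Real.exp x := by
  have h := Complex.norm_exp_sub_sum_le_norm_mul_exp x N
  rw [Complex.norm_of_nonneg hx] at h
  exact_mod_cast h

lemma puiseuxG_eq {α β : ℝ} {i j : ℕ} (h : j ≤ 2 * i) (h' : i ≤ j) :
    puiseuxG α β i j =
      β ^ (2 * i - j) / Nat.factorial (2 * i - j) * sqrtCoef α (2 * i - j) i := by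
  rw [puiseuxG, if_pos h, sqrtCoef, Finset.mul_sum,
    ← Finset.sum_subset (Finset.range_subset_range.2 (show j - i + 1 ≤ i + 1 by omega))]
  · exact Finset.sum_congr rfl fun p _ => by ring
  · intro p hp hp'
    rw [mem_range] at hp hp'
    rw [compS_of_lt (by omega)]; ring

lemma sum_sqrtCoef_eq_sum_puiseuxG (α β : ℝ) (μ : ℕ → ℝ) (p : ℕ) :
    ∑ m ∈ range (p + 1), β ^ m / Nat.factorial m *
      (if 2 ∣ p + m then sqrtCoef α m ((p + m) / 2) * μ ((p + m) / 2) else 0) =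
    ∑ i ∈ Icc ((p + 1) / 2) p, μ i * puiseuxG α β i p := by
  simp_rw [mul_ite, mul_zero]
  rw [← Finset.sum_filter]
  refine Finset.sum_bij' (fun m _ => (p + m) / 2) (fun i _ => 2 * i - p) ?_ ?_ ?_ ?_ ?_
  · intro m hm
    simp only [mem_filter, mem_range, mem_Icc] at hm ⊢
    omega
  · intro m hm
    simp only [mem_filter, mem_range, mem_Icc] at hm ⊢
    omega
  · intro m hm
    simp only [mem_filter, mem_range] at hm
    omega
  · intro m hm
    simp only [mem_Icc] at hm
    omega
  · intro m hm
    simp only [mem_filter, mem_range] at hm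
    rw [puiseuxG_eq (by omega) (by omega), show 2 * ((p + m) / 2) - p = m by omega]
    ring

section Averages

variable {ν : Measure ℝ} {β : ℝ}

lemma sqrt_sub_self_bounds {t b : ℝ} (ht : 1 ≤ t) (hb : 0 < b) :
    0 ≤ √(t ^ 2 + b) - t ∧ √(t ^ 2 + b) - t ≤ b * t⁻¹ ∧ √(t ^ 2 + b) - t ≤ √b := by
  have ht0 : 0 < t := by linarith
  refine ⟨sub_nonneg.2 (Real.le_sqrt_of_sq_le (by linarith)), ?_, ?_⟩
  · rw [sub_le_iff_le_add]
    refine Real.sqrt_le_iff.2 ⟨by positivity, ?_⟩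
    have : (b * t⁻¹ + t) ^ 2 = (b * t⁻¹) ^ 2 + 2 * b + t ^ 2 := by field_simp; ring
    rw [this]; nlinarith [sq_nonneg (b * t⁻¹)]
  · rw [sub_le_iff_le_add]
    refine Real.sqrt_le_iff.2 ⟨by positivity, ?_⟩
    nlinarith [Real.sq_sqrt hb.le, Real.sqrt_nonneg b]

lemma one_add_div_sq_rpow_le {t b : ℝ} (ht : 1 ≤ t) (hb : 0 < b) (α : ℝ) :
    (1 + b / t ^ 2) ^ α ≤ (1 + b) ^ ⌈|α|⌉₊ := by
  have h1 : b / t ^ 2 ≤ b := div_le_self hb.le (one_le_pow₀ ht)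
  have h2 : 0 < b / t ^ 2 := by positivity
  calc (1 + b / t ^ 2) ^ α ≤ (1 + b / t ^ 2) ^ (⌈|α|⌉₊ : ℝ) :=
        Real.rpow_le_rpow_of_exponent_le (by linarith) ((le_abs_self α).trans (Nat.le_ceil _))
    _ = (1 + b / t ^ 2) ^ ⌈|α|⌉₊ := Real.rpow_natCast _ _
    _ ≤ _ := by gcongr

variable (hν : ∀ᵐ b ∂ν, 0 < b) (hβ : 0 < β)
  (hm : ∀ M : ℕ, Integrable (fun b => (1 + b) ^ M * Real.exp (β * √b)) ν)

include hν hβ hm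

lemma integrable_one_add_pow (M : ℕ) : Integrable (fun b => (1 + b) ^ M) ν := by
  refine (hm M).mono' (by fun_prop) ?_
  filter_upwards [hν] with b hb
  rw [Real.norm_of_nonneg (by positivity)]
  exact le_mul_of_one_le_right (by positivity) (Real.one_le_exp (by positivity))

lemma integrable_sqrt_kernel (α : ℝ) {t : ℝ} (ht : 1 ≤ t) :
    Integrable (fun b => (1 + b / t ^ 2) ^ α * Real.exp (β * (√(t ^ 2 + b) - t))) ν := by
  refine (hm ⌈|α|⌉₊).mono' (by fun_prop) ?_
  filter_upwards [hν] with b hb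
  rw [Real.norm_of_nonneg (by positivity)]
  have := one_add_div_sq_rpow_le ht hb α
  have := (sqrt_sub_self_bounds ht hb).2.2
  gcongr

lemma asympExp_integral_sqrt_kernel (α : ℝ) :
    AsympExp (fun t => ∫ b, (1 + b / t ^ 2) ^ α * Real.exp (β * (√(t ^ 2 + b) - t)) ∂ν)
      (fun j => ∑ i ∈ Icc ((j + 1) / 2) j, (∫ b, b ^ i ∂ν) * puiseuxG α β i j) := by
  have hpow := integrable_one_add_pow hν hβ hm
  set h : ℕ → ℝ → ℝ := fun m w => (√(1 + w) - 1) ^ m * (1 + w) ^ α with hh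
  have hhm : ∀ m, Measurable (h m) := fun m => by fun_prop
  refine (AsympExp.nested
    (F := fun m t => β ^ m / Nat.factorial m * (t ^ m * ∫ b, h m (b / t ^ 2) ∂ν))
    (d := fun m p => β ^ m / Nat.factorial m *
      (if 2 ∣ p + m then sqrtCoef α m ((p + m) / 2) * ∫ b, b ^ ((p + m) / 2) ∂ν else 0))
    ?_ (fun m => ?_) ?_).congr_coeff
    fun p => sum_sqrtCoef_eq_sum_puiseuxG α β (fun i => ∫ b, b ^ i ∂ν) p
  · intro N
    refine IsBigO.of_bound (∫ b, β ^ N * ((1 + b) ^ (⌈|α|⌉₊ + N) * Real.exp (β * √b)) ∂ν) ?_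
    filter_upwards [eventually_ge_atTop 1] with t ht
    have ht0 : 0 < t := by linarith
    have hI : ∀ m ∈ range N,
        Integrable (fun b => β ^ m / Nat.factorial m * (t ^ m * h m (b / t ^ 2))) ν := by
      intro m _
      refine Integrable.const_mul (Integrable.const_mul ?_ _) _
      obtain ⟨C, M, hC, hM⟩ := sqrt_one_add_rpow_bound α m 0
      refine ((hpow M).const_mul C).mono'
        ((hhm m).comp (by fun_prop)).aestronglyMeasurable ?_
      filter_upwards [hν] with b hb
      have h1 : b / t ^ 2 ≤ b := div_le_self hb.le (one_le_pow₀ ht)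
      have h2 : 0 < b / t ^ 2 := by positivity
      have h3 := hM _ h2
      simp only [range_zero, sum_empty, sub_zero, pow_zero, one_mul] at h3
      exact h3.trans (by gcongr)
    simp_rw [← integral_const_mul]
    rw [← integral_finsetSum _ hI, ← integral_sub (integrable_sqrt_kernel hν hβ hm α ht)
      (integrable_finsetSum _ hI), norm_pow, Real.norm_of_nonneg (by positivity : 0 ≤ t⁻¹),
      ← integral_mul_const]
    refine norm_integral_le_of_norm_le (((hm _).const_mul _).mul_const _) ?_
    filter_upwards [hν] with b hb
    obtain ⟨h1, h2, h3⟩ := sqrt_sub_self_bounds ht hb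
    have hs : √(t ^ 2 + b) = t * √(1 + b / t ^ 2) := by
      rw [show t ^ 2 + b = t ^ 2 * (1 + b / t ^ 2) by field_simp,
        Real.sqrt_mul (by positivity), Real.sqrt_sq ht0.le]
    set E := β * (√(t ^ 2 + b) - t) with hE
    have hE0 : 0 ≤ E := by positivity
    have hE' : E = β * t * (√(1 + b / t ^ 2) - 1) := by rw [hE, hs]; ring
    have e : (1 + b / t ^ 2) ^ α * Real.exp E -
        ∑ m ∈ range N, β ^ m / Nat.factorial m * (t ^ m * h m (b / t ^ 2)) =
        (1 + b / t ^ 2) ^ α * (Real.exp E - ∑ m ∈ range N, E ^ m / Nat.factorial m) := by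
      rw [mul_sub, Finset.mul_sum]
      congr 1
      refine Finset.sum_congr rfl fun m _ => ?_
      rw [hE', mul_pow, mul_pow]; ring
    rw [e, norm_mul, Real.norm_of_nonneg (by positivity), Real.norm_eq_abs]
    calc _ ≤ (1 + b) ^ ⌈|α|⌉₊ * (E ^ N * Real.exp E) := by
          have := one_add_div_sq_rpow_le ht hb α
          have := exp_sub_sum_le hE0 N
          gcongr
      _ ≤ (1 + b) ^ ⌈|α|⌉₊ * ((β * ((1 + b) * t⁻¹)) ^ N * Real.exp (β * √b)) := by
          have : E ≤ β * ((1 + b) * t⁻¹) := by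
            rw [hE]; gcongr; exact h2.trans (by gcongr; linarith)
          have h6 : E ≤ β * √b := by rw [hE]; gcongr
          gcongr
      _ = _ := by rw [mul_pow, mul_pow, pow_add]; ring
  · have := (asympExp_integral_div hν hpow (hhm m) (sqrt_one_add_rpow_bound α m)).comp_sq (m := m)
      fun i hi => by rw [sqrtCoef_of_lt hi, zero_mul]
    exact this.const_mul _
  · intro m p hp
    split_ifs with hd
    · rw [sqrtCoef_of_lt (by omega)]; ring
    · simp

lemma asympExp_integral_bessel (α : ℝ) {H : ℝ → ℝ} {a : ℕ → ℝ} (hH : Measurable H)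
    (ha : AsympExp H a) :
    AsympExp (fun t => ∫ b, (1 + b / t ^ 2) ^ α * Real.exp (β * (√(t ^ 2 + b) - t)) *
        H (β * √(t ^ 2 + b)) ∂ν)
      (fun p => ∑ k ∈ range (p + 1), a k * β⁻¹ ^ k *
        ∑ i ∈ Icc ((p - k + 1) / 2) (p - k),
          (∫ b, b ^ i ∂ν) * puiseuxG (α - k / 2) β i (p - k)) := by
  refine (AsympExp.nested
    (F := fun k t => a k * β⁻¹ ^ k * (t⁻¹ ^ k *
      ∫ b, (1 + b / t ^ 2) ^ (α - k / 2) * Real.exp (β * (√(t ^ 2 + b) - t)) ∂ν))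
    (d := fun k p => a k * β⁻¹ ^ k * (if k ≤ p then
      ∑ i ∈ Icc ((p - k + 1) / 2) (p - k),
          (∫ b, b ^ i ∂ν) * puiseuxG (α - k / 2) β i (p - k) else 0))
    ?_ (fun k => ((asympExp_integral_sqrt_kernel hν hβ hm (α - k / 2)).shift k).const_mul _)
    ?_).congr_coeff fun p => ?_
  · have key : ∀ N : ℕ, ∃ C, ∀ᶠ t : ℝ in atTop, ∀ b, 0 < b →
        |H (β * √(t ^ 2 + b)) - ∑ k ∈ range N, a k * (β * √(t ^ 2 + b))⁻¹ ^ k| ≤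
          C * t⁻¹ ^ N := by
      intro N
      obtain ⟨C, hC, hb⟩ := (ha N).exists_nonneg
      obtain ⟨Z, hZ⟩ := eventually_atTop.1 hb.bound
      refine ⟨C * β⁻¹ ^ N, ?_⟩
      filter_upwards [eventually_ge_atTop (Z / β), eventually_gt_atTop 0] with t ht ht0 b hb
      have h1 : t ≤ √(t ^ 2 + b) := Real.le_sqrt_of_sq_le (by linarith)
      have h2 : β * t ≤ β * √(t ^ 2 + b) := by gcongr
      have h3 := hZ (β * √(t ^ 2 + b)) (by rw [div_le_iff₀ hβ] at ht; linarith)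
      have h4 : (β * √(t ^ 2 + b))⁻¹ ≤ β⁻¹ * t⁻¹ := by
        rw [← mul_inv]; gcongr
      rw [norm_pow, Real.norm_of_nonneg (by positivity : 0 ≤ (β * √(t ^ 2 + b))⁻¹)] at h3
      calc _ ≤ C * (β * √(t ^ 2 + b))⁻¹ ^ N := h3
        _ ≤ C * (β⁻¹ * t⁻¹) ^ N := by gcongr
        _ = _ := by rw [mul_pow]; ring
    intro N
    obtain ⟨C, hC⟩ := key N
    obtain ⟨C₀, hC₀⟩ := key 0
    refine IsBigO.of_bound (∫ b, C * ((1 + b) ^ ⌈|α|⌉₊ * Real.exp (β * √b)) ∂ν) ?_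
    filter_upwards [eventually_ge_atTop 1, hC, hC₀] with t ht hC hC₀
    have ht0 : 0 < t := by linarith
    have hI : ∀ k ∈ range N, Integrable (fun b => a k * β⁻¹ ^ k * (t⁻¹ ^ k *
        ((1 + b / t ^ 2) ^ (α - k / 2) * Real.exp (β * (√(t ^ 2 + b) - t))))) ν :=
      fun k _ => ((integrable_sqrt_kernel hν hβ hm _ ht).const_mul _).const_mul _
    have hI' : Integrable (fun b => (1 + b / t ^ 2) ^ α * Real.exp (β * (√(t ^ 2 + b) - t)) *
        H (β * √(t ^ 2 + b))) ν := by
      refine ((integrable_sqrt_kernel hν hβ hm α ht).mul_const C₀).mono'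
        (Measurable.mul (by fun_prop) (hH.comp (by fun_prop))).aestronglyMeasurable ?_
      filter_upwards [hν] with b hb
      rw [norm_mul, Real.norm_of_nonneg (by positivity)]
      gcongr
      simpa using hC₀ b hb
    simp_rw [← integral_const_mul]
    rw [← integral_finsetSum _ hI, ← integral_sub hI' (integrable_finsetSum _ hI), norm_pow,
      Real.norm_of_nonneg (by positivity : 0 ≤ t⁻¹), integral_const_mul, ← integral_const_mul,
      ← integral_mul_const]
    refine norm_integral_le_of_norm_le (((hm _).const_mul _).mul_const _) ?_
    filter_upwards [hν] with b hb
    have hw : 0 < 1 + b / t ^ 2 := by positivity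
    have hs : √(t ^ 2 + b) = t * √(1 + b / t ^ 2) := by
      rw [show t ^ 2 + b = t ^ 2 * (1 + b / t ^ 2) by field_simp,
        Real.sqrt_mul (by positivity), Real.sqrt_sq ht0.le]
    have e : ∀ k : ℕ, (β * √(t ^ 2 + b))⁻¹ ^ k =
        β⁻¹ ^ k * t⁻¹ ^ k * (1 + b / t ^ 2) ^ (-(k:ℝ) / 2) := by
      intro k
      rw [hs, mul_inv, mul_inv, mul_pow, mul_pow, Real.sqrt_eq_rpow, ← Real.rpow_neg hw.le,
        ← Real.rpow_natCast (_ ^ (_:ℝ)), ← Real.rpow_mul hw.le, mul_assoc]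
      congr 3; ring
    have e2 : (1 + b / t ^ 2) ^ α * Real.exp (β * (√(t ^ 2 + b) - t)) * H (β * √(t ^ 2 + b)) -
        ∑ k ∈ range N, a k * β⁻¹ ^ k * (t⁻¹ ^ k *
        ((1 + b / t ^ 2) ^ (α - k / 2) * Real.exp (β * (√(t ^ 2 + b) - t)))) =
        (1 + b / t ^ 2) ^ α * Real.exp (β * (√(t ^ 2 + b) - t)) *
          (H (β * √(t ^ 2 + b)) - ∑ k ∈ range N, a k * (β * √(t ^ 2 + b))⁻¹ ^ k) := by
      rw [mul_sub _ (H _), Finset.mul_sum]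
      congr 1
      refine Finset.sum_congr rfl fun k _ => ?_
      rw [e, show α - (k:ℝ) / 2 = α + -(k:ℝ) / 2 by ring, Real.rpow_add hw]; ring
    rw [e2, norm_mul, Real.norm_of_nonneg (by positivity), Real.norm_eq_abs]
    have h5 := hC b hb
    have hC0 : 0 ≤ C * t⁻¹ ^ N := (abs_nonneg _).trans h5
    calc _ ≤ ((1 + b) ^ ⌈|α|⌉₊ * Real.exp (β * √b)) * (C * t⁻¹ ^ N) := by
          have := one_add_div_sq_rpow_le ht hb α
          have := (sqrt_sub_self_bounds ht hb).2.2
          gcongr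
      _ = _ := by ring
  · intro k p h
    simp [not_le.2 h]
  · refine Finset.sum_congr rfl fun k hk => ?_
    rw [if_pos (by simpa [Nat.lt_succ_iff] using hk)]

end Averages

open ProbabilityTheory in
/-- Finite measures on `ℝ` whose moment generating functions are finite and agree near `0` are
equal. -/
theorem ext_of_mgf_eq_near_zero {μ ν : Measure ℝ} [IsFiniteMeasure μ] [IsFiniteMeasure ν] {δ : ℝ}
    (hδ : 0 < δ)
    (hμ : ∀ t ∈ Set.Ioo (-δ) δ, Integrable (fun x => Real.exp (t * x)) μ)
    (hν : ∀ t ∈ Set.Ioo (-δ) δ, Integrable (fun x => Real.exp (t * x)) ν)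
    (h : ∀ t ∈ Set.Ioo (-δ) δ, ∫ x, Real.exp (t * x) ∂μ = ∫ x, Real.exp (t * x) ∂ν) :
    μ = ν := by
  have hsub : ∀ {κ : Measure ℝ}, (∀ t ∈ Set.Ioo (-δ) δ, Integrable (fun x => Real.exp (t * x)) κ) →
      Set.Ioo (-δ) δ ⊆ interior (integrableExpSet id κ) := fun hκ =>
    interior_maximal (fun t ht => hκ t ht) isOpen_Ioo
  have hS : {z : ℂ | z.re ∈ Set.Ioo (-δ) δ} = Complex.reLm ⁻¹' Set.Ioo (-δ) δ := rfl
  have hreal : ∃ᶠ x : ℝ in 𝓝[≠] 0, complexMGF id μ x = complexMGF id ν x := by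
    refine Eventually.frequently ?_
    filter_upwards [mem_nhdsWithin_of_mem_nhds (Ioo_mem_nhds (neg_neg_of_pos hδ) hδ)] with x hx
    rw [complexMGF_ofReal, complexMGF_ofReal]
    congr 1
    exact h x hx
  have heq : Set.EqOn (complexMGF id μ) (complexMGF id ν) {z : ℂ | z.re ∈ Set.Ioo (-δ) δ} := by
    refine AnalyticOnNhd.eqOn_of_preconnected_of_frequently_eq
      (analyticOnNhd_complexMGF.mono fun z hz => hsub hμ hz)
      (analyticOnNhd_complexMGF.mono fun z hz => hsub hν hz)
      (hS ▸ ((convex_Ioo (-δ) δ).linear_preimage Complex.reLm).isPreconnected)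
      (z₀ := ((0 : ℝ) : ℂ)) (by simp [hδ]) ?_
    rw [frequently_iff_seq_forall] at hreal ⊢
    obtain ⟨xs, hx, hx_eq⟩ := hreal
    refine ⟨fun n => xs n, ?_, fun n => hx_eq n⟩
    rw [tendsto_nhdsWithin_iff] at hx ⊢
    exact ⟨(Complex.continuous_ofReal.tendsto _).comp hx.1, by simpa using hx.2⟩
  refine Measure.ext_of_charFun (funext fun t => ?_)
  have := heq (show ((t : ℂ) * Complex.I).re ∈ Set.Ioo (-δ) δ by simp [hδ])
  simp only [complexMGF] at this
  rw [charFun_apply_real, charFun_apply_real]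
  convert this using 4 <;> simp <;> ring

/-- The exponential of a quadratic polynomial, integrated over the line. -/
lemma lintegral_exp_quadratic {p : ℝ} (hp : 0 < p) (q c : ℝ) :
    ∫⁻ x : ℝ, ENNReal.ofReal (Real.exp (-p * x ^ 2 + q * x + c)) =
      ENNReal.ofReal (√(Real.pi / p) * Real.exp (q ^ 2 / (4 * p) + c)) := by
  have e : ∀ x : ℝ, Real.exp (-p * x ^ 2 + q * x + c) =
      Real.exp (-p * (x + -(q / (2 * p))) ^ 2) * Real.exp (q ^ 2 / (4 * p) + c) := by
    intro x
    rw [← Real.exp_add]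
    congr 1
    field_simp
    ring
  have hi : Integrable fun x : ℝ => Real.exp (-p * (x + -(q / (2 * p))) ^ 2) :=
    (integrable_exp_neg_mul_sq hp).comp_add_right _
  simp_rw [e]
  rw [← ofReal_integral_eq_lintegral_ofReal (hi.mul_const _)
    (ae_of_all _ fun x => by positivity), integral_mul_const,
    integral_add_right_eq_self (fun x => Real.exp (-p * x ^ 2)), integral_gaussian]

lemma poch_pos {a : ℝ} (ha : 0 < a) (j : ℕ) : 0 < poch a j :=
  Finset.prod_pos fun t _ => by positivity

lemma pow_le_poch {a : ℝ} (ha : 0 < a) (j : ℕ) : a ^ j ≤ poch a j := by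
  rw [poch, ← Finset.card_range j, ← Finset.prod_const, Finset.card_range]
  exact Finset.prod_le_prod (fun _ _ => ha.le) fun t _ => by simp

lemma summable_hypH {a : ℝ} (ha : 0 < a) (z : ℝ) :
    Summable fun j : ℕ => (z ^ 2 / 4) ^ j / (Nat.factorial j * Real.Gamma (a + j)) := by
  have hG := Real.Gamma_pos_of_pos ha
  refine Summable.of_nonneg_of_le
    (fun j => by have := Real.Gamma_pos_of_pos (show 0 < a + j by positivity); positivity)
    (fun j => ?_) ((Real.summable_pow_div_factorial (z ^ 2 / 4 / a)).mul_right (Real.Gamma a)⁻¹)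
  have := pow_le_poch ha j
  rw [Gamma_add_nat ha]
  calc _ ≤ (z ^ 2 / 4) ^ j / (Nat.factorial j * (a ^ j * Real.Gamma a)) := by gcongr
    _ = _ := by rw [div_pow _ a]; field_simp

lemma measurable_hypH {a : ℝ} (ha : 0 < a) : Measurable (hypH a) := by
  have h : hypH a = fun z => (∑' j : ℕ, ENNReal.ofReal
      ((z ^ 2 / 4) ^ j / (Nat.factorial j * Real.Gamma (a + j)))).toReal := by
    funext z
    have h0 : ∀ j : ℕ, 0 ≤ (z ^ 2 / 4) ^ j / (Nat.factorial j * Real.Gamma (a + j)) := fun j => by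
      have := Real.Gamma_pos_of_pos (show 0 < a + j by positivity); positivity
    rw [← ENNReal.ofReal_tsum_of_nonneg h0 (summable_hypH ha z),
      ENNReal.toReal_ofReal (tsum_nonneg h0), hypH]
  rw [h]
  exact (Measurable.tsum fun j => by fun_prop).ennreal_toReal

lemma hypH_nonneg {a : ℝ} (ha : 0 < a) (z : ℝ) : 0 ≤ hypH a z :=
  tsum_nonneg fun j => by
    have := Real.Gamma_pos_of_pos (show 0 < a + j by positivity); positivity

lemma summable_hypM {a : ℝ} (ha : 0 < a) (i : ℕ) {x : ℝ} (hx : 0 ≤ x) :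
    Summable fun j : ℕ => poch (a + i) j / poch a j * x ^ j / (Nat.factorial j) := by
  refine Summable.of_nonneg_of_le
    (fun j => by
      have := poch_pos ha j; have := poch_pos (show 0 < a + i by positivity) j; positivity)
    (fun j => ?_) (Real.summable_pow_div_factorial ((a + i) / a * x))
  rw [mul_pow]
  gcongr
  rw [poch, poch, ← Finset.prod_div_distrib]
  refine (Finset.prod_le_prod (g := fun _ => (a + i) / a) (fun t _ => by positivity)
    fun t _ => ?_).trans_eq (by simp [div_pow])
  rw [div_le_div_iff₀ (by positivity) ha]
  have : (0:ℝ) ≤ i * t := by positivity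
  nlinarith

lemma hypM_self {a : ℝ} (ha : 0 < a) (x : ℝ) : hypM a a x = Real.exp x := by
  rw [hypM, Real.exp_eq_exp_ℝ, NormedSpace.exp_eq_tsum_div]
  congr 1
  funext j
  rw [div_self (poch_pos ha j).ne', one_mul]

/-- The `j`-th Poisson-weighted gamma density in the density of a noncentral gamma law. -/
def ncGammaTerm (a L r : ℝ) (j : ℕ) (w : ℝ) : ℝ :=
  Real.exp (-L) * L ^ j / Nat.factorial j * (r ^ (a + j) / Real.Gamma (a + j)) *
    (w ^ (a + j - 1) * Real.exp (-(r * w)))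

/-- The noncentral gamma law: the mixture of the gamma laws of shape `a + J` and rate `r`, where
`J` is Poisson with mean `L`. -/
def ncGamma (a L r : ℝ) : Measure ℝ :=
  (volume.restrict (Set.Ioi 0)).withDensity fun w => ∑' j, ENNReal.ofReal (ncGammaTerm a L r j w)

lemma measurable_ncGammaTerm (a L r : ℝ) (j : ℕ) : Measurable (ncGammaTerm a L r j) := by
  unfold ncGammaTerm
  fun_prop

lemma ae_ncGamma_pos (a L r : ℝ) : ∀ᵐ w ∂ncGamma a L r, 0 < w :=
  (withDensity_absolutelyContinuous _ _).ae_le (ae_restrict_mem measurableSet_Ioi)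

section NoncentralGamma

variable {a L r : ℝ} (ha : 0 < a) (hL : 0 ≤ L) (hr : 0 < r)
include ha hL hr

lemma tsum_ncGammaTerm {w : ℝ} (hw : 0 < w) :
    ∑' j, ENNReal.ofReal (ncGammaTerm a L r j w) =
      ENNReal.ofReal (Real.exp (-L) * r ^ a * w ^ (a - 1) * Real.exp (-(r * w)) *
        hypH a (2 * √(L * r * w))) := by
  have h0 : ∀ j, 0 ≤ ncGammaTerm a L r j w := fun j => by
    have := Real.Gamma_pos_of_pos (show 0 < a + j by positivity)
    unfold ncGammaTerm; positivity
  have h := ((summable_hypH ha (2 * √(L * r * w))).hasSum.mul_left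
    (Real.exp (-L) * r ^ a * w ^ (a - 1) * Real.exp (-(r * w)))).congr_fun
    (g := fun j => ncGammaTerm a L r j w) fun j => by
      have := Real.Gamma_pos_of_pos (show 0 < a + j by positivity)
      rw [ncGammaTerm, Real.rpow_add hr, show a + j - 1 = (a - 1) + j by ring, Real.rpow_add hw,
        Real.rpow_natCast, Real.rpow_natCast, mul_pow, Real.sq_sqrt (by positivity)]
      field_simp
      rw [show L * r * w * 2 ^ 2 / 4 = L * r * w by ring, mul_pow, mul_pow]
  rw [← ENNReal.ofReal_tsum_of_nonneg h0 h.summable, h.tsum_eq, hypH]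

lemma lintegral_ncGamma_pow_mul_exp (i : ℕ) {τ : ℝ} (hτ : τ < r) :
    ∫⁻ w, ENNReal.ofReal (w ^ i * Real.exp (τ * w)) ∂ncGamma a L r =
      ENNReal.ofReal (Real.exp (-L) * (r / (r - τ)) ^ a * (r - τ)⁻¹ ^ i * poch a i *
        hypM (a + i) a (L * (r / (r - τ)))) := by
  have hrτ : 0 < r - τ := sub_pos.2 hτ
  have hx : 0 ≤ L * (r / (r - τ)) := by positivity
  have hGa := Real.Gamma_pos_of_pos ha
  have hterm : ∀ j : ℕ, ∫⁻ w in Set.Ioi 0, ENNReal.ofReal (ncGammaTerm a L r j w) *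
      ENNReal.ofReal (w ^ i * Real.exp (τ * w)) =
      ENNReal.ofReal (Real.exp (-L) * (r / (r - τ)) ^ a * (r - τ)⁻¹ ^ i * poch a i *
        (poch (a + i) j / poch a j * (L * (r / (r - τ))) ^ j / (Nat.factorial j))) := by
    intro j
    have hc : 0 < a + j := by positivity
    have hG := Real.Gamma_pos_of_pos hc
    have e : ∀ w ∈ Set.Ioi (0:ℝ), ENNReal.ofReal (ncGammaTerm a L r j w) *
        ENNReal.ofReal (w ^ i * Real.exp (τ * w)) =
        ENNReal.ofReal (Real.exp (-L) * L ^ j / Nat.factorial j *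
          (r ^ (a + j) / Real.Gamma (a + j)) *
          (w ^ (a + j - 1) * Real.exp (-((r - τ) * w)) * w ^ i)) := by
      intro w hw
      have hw : 0 < w := hw
      rw [← ENNReal.ofReal_mul (by unfold ncGammaTerm; positivity), ncGammaTerm,
        show -((r - τ) * w) = -(r * w) + τ * w by ring, Real.exp_add]
      congr 1; ring
    rw [setLIntegral_congr_fun measurableSet_Ioi e, ← ofReal_integral_eq_lintegral_ofReal
      ((integrableOn_rpow_mul_exp_neg_mul hc hrτ i).const_mul _)
      ((ae_restrict_iff' measurableSet_Ioi).2 (ae_of_all _ fun w hw => by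
        have hw : 0 < w := hw
        positivity)), integral_const_mul, integral_rpow_mul_exp_neg_mul hc hrτ i]
    congr 1
    rw [show a + (j:ℝ) + i = a + i + j by ring, Gamma_add_nat (by positivity : 0 < a + i) j,
      Gamma_add_nat ha i, Gamma_add_nat ha j, Real.rpow_neg hrτ.le, Real.rpow_add hr,
      Real.rpow_add hrτ, Real.rpow_natCast, Real.rpow_natCast, Real.div_rpow hr.le hrτ.le,
      mul_pow, div_pow]
    have := poch_pos ha j
    field_simp
  rw [ncGamma, lintegral_withDensity_eq_lintegral_mul _
    (Measurable.tsum fun j => (measurable_ncGammaTerm a L r j).ennreal_ofReal)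
    (by fun_prop)]
  simp_rw [Pi.mul_apply, ← ENNReal.tsum_mul_right]
  rw [lintegral_tsum fun j => by have := measurable_ncGammaTerm a L r j; fun_prop]
  simp_rw [hterm]
  have hp := poch_pos ha i
  rw [← ENNReal.ofReal_tsum_of_nonneg (fun j => by
      have := poch_pos ha j; have := poch_pos (show 0 < a + i by positivity) j; positivity)
    ((summable_hypM ha i hx).mul_left _), tsum_mul_left, hypM]

lemma lintegral_ncGamma_exp {τ : ℝ} (hτ : τ < r) :
    ∫⁻ w, ENNReal.ofReal (Real.exp (τ * w)) ∂ncGamma a L r =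
      ENNReal.ofReal ((r / (r - τ)) ^ a * Real.exp (L * (τ / (r - τ)))) := by
  have h := lintegral_ncGamma_pow_mul_exp ha hL hr 0 hτ
  simp only [pow_zero, one_mul, Nat.cast_zero, add_zero, hypM_self ha, mul_one] at h
  rw [h]
  have : r - τ ≠ 0 := (sub_pos.2 hτ).ne'
  rw [show L * (τ / (r - τ)) = -L + L * (r / (r - τ)) by field_simp; ring, Real.exp_add]
  congr 1
  simp [poch]
  ring

lemma isProbabilityMeasure_ncGamma : IsProbabilityMeasure (ncGamma a L r) :=
  ⟨by simpa [div_self hr.ne'] using lintegral_ncGamma_exp ha hL hr (τ := 0) hr⟩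

lemma integrable_exp_ncGamma {τ : ℝ} (hτ : τ < r) :
    Integrable (fun w => Real.exp (τ * w)) (ncGamma a L r) := by
  refine ⟨by fun_prop, ?_⟩
  rw [hasFiniteIntegral_iff_ofReal (ae_of_all _ fun _ => (Real.exp_pos _).le),
    lintegral_ncGamma_exp ha hL hr hτ]
  exact ENNReal.ofReal_lt_top

lemma integral_exp_ncGamma {τ : ℝ} (hτ : τ < r) :
    ∫ w, Real.exp (τ * w) ∂ncGamma a L r =
      (r / (r - τ)) ^ a * Real.exp (L * (τ / (r - τ))) := by
  rw [integral_eq_lintegral_of_nonneg_ae (ae_of_all _ fun _ => (Real.exp_pos _).le)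
    (by fun_prop), lintegral_ncGamma_exp ha hL hr hτ, ENNReal.toReal_ofReal]
  have := sub_pos.2 hτ
  positivity

lemma integral_ncGamma_pow_mul_exp (i : ℕ) {τ : ℝ} (hτ : τ < r) :
    ∫ w, w ^ i * Real.exp (τ * w) ∂ncGamma a L r =
      Real.exp (-L) * (r / (r - τ)) ^ a * (r - τ)⁻¹ ^ i * poch a i *
        hypM (a + i) a (L * (r / (r - τ))) := by
  rw [integral_eq_lintegral_of_nonneg_ae, lintegral_ncGamma_pow_mul_exp ha hL hr i hτ,
    ENNReal.toReal_ofReal]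
  · have := sub_pos.2 hτ
    have := poch_pos ha i
    have : 0 ≤ hypM (a + i) a (L * (r / (r - τ))) := tsum_nonneg fun j => by
      have := poch_pos ha j; have := poch_pos (show 0 < a + i by positivity) j; positivity
    positivity
  · filter_upwards [ae_ncGamma_pos a L r] with w hw
    positivity
  · fun_prop

lemma ncGamma_Ioi {c : ℝ} (hc : 0 ≤ c) :
    ncGamma a L r (Set.Ioi c) = ∫⁻ w in Set.Ioi c,
      ENNReal.ofReal (Real.exp (-L) * r ^ a * w ^ (a - 1) * Real.exp (-(r * w)) *
        hypH a (2 * √(L * r * w))) := by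
  rw [ncGamma, withDensity_apply _ measurableSet_Ioi, Measure.restrict_restrict measurableSet_Ioi,
    Set.Ioi_inter_Ioi, sup_of_le_left hc]
  exact setLIntegral_congr_fun measurableSet_Ioi fun w hw =>
    tsum_ncGammaTerm ha hL hr (hc.trans_lt hw)

end NoncentralGamma

section ProductLaw

variable {μX μY σX σY ρ : ℝ} (hσX : 0 < σX) (hσY : 0 < σY) (hρ₁ : -1 < ρ) (hρ₂ : ρ < 1)
include hσX hσY hρ₁ hρ₂

lemma lintegral_exp_mul_biNormPDF {τ : ℝ} (h1 : 0 < 1 - (1 + ρ) * τ) (h2 : 0 < 1 + (1 - ρ) * τ) :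
    ∫⁻ v, ENNReal.ofReal (Real.exp (τ / (σX * σY) * (v.1 * v.2)))
      ∂((volume : Measure (ℝ × ℝ)).withDensity
        fun v => ENNReal.ofReal (biNormPDF μX μY σX σY ρ v)) =
    ENNReal.ofReal ((√((1 - (1 + ρ) * τ) * (1 + (1 - ρ) * τ)))⁻¹ *
      Real.exp (((μX / σX + τ * (μY / σY - ρ * (μX / σX))) ^ 2) /
        (2 * ((1 - (1 + ρ) * τ) * (1 + (1 - ρ) * τ))) - (μX / σX) ^ 2 / 2)) := by
  have hD : 0 < 1 - ρ ^ 2 := by nlinarith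
  have hQ : 0 < (1 - (1 + ρ) * τ) * (1 + (1 - ρ) * τ) := mul_pos h1 h2
  have hpdf : Measurable (biNormPDF μX μY σX σY ρ) := by unfold biNormPDF; fun_prop
  set K := (2 * Real.pi * σX * σY * √(1 - ρ ^ 2))⁻¹ with hK
  have hK0 : 0 ≤ K := by positivity
  have hin : ∀ x : ℝ, ∫⁻ y : ℝ, ENNReal.ofReal (biNormPDF μX μY σX σY ρ (x, y)) *
      ENNReal.ofReal (Real.exp (τ / (σX * σY) * (x * y))) =
      ENNReal.ofReal (K * (√(2 * Real.pi * (1 - ρ ^ 2)) * σY)) * ENNReal.ofReal (Real.exp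
        (-((1 - (1 + ρ) * τ) * (1 + (1 - ρ) * τ) / (2 * σX ^ 2)) * x ^ 2 +
        ((μX / σX + τ * (μY / σY - ρ * (μX / σX))) / σX) * x + -((μX / σX) ^ 2 / 2))) := by
    intro x
    have e : ∀ y : ℝ, ENNReal.ofReal (biNormPDF μX μY σX σY ρ (x, y)) *
        ENNReal.ofReal (Real.exp (τ / (σX * σY) * (x * y))) =
        ENNReal.ofReal K * ENNReal.ofReal (Real.exp
          (-(1 / (2 * (1 - ρ ^ 2) * σY ^ 2)) * y ^ 2 +
          (((ρ * (x / σX - μX / σX) + μY / σY) / (1 - ρ ^ 2) + τ * (x / σX)) / σY) * y +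
          -((2 * (1 - ρ ^ 2))⁻¹ * ((x / σX - μX / σX) ^ 2 +
            2 * ρ * (x / σX - μX / σX) * (μY / σY) + (μY / σY) ^ 2)))) := by
      intro y
      rw [biNormPDF, ← hK, ENNReal.ofReal_mul hK0, mul_assoc,
        ← ENNReal.ofReal_mul (Real.exp_pos _).le, ← Real.exp_add]
      congr 3
      field_simp
      ring
    have hroot : √(Real.pi / (1 / (2 * (1 - ρ ^ 2) * σY ^ 2))) =
        √(2 * Real.pi * (1 - ρ ^ 2)) * σY := by
      rw [show Real.pi / (1 / (2 * (1 - ρ ^ 2) * σY ^ 2)) =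
        (2 * Real.pi * (1 - ρ ^ 2)) * σY ^ 2 by field_simp, Real.sqrt_mul (by positivity),
        Real.sqrt_sq hσY.le]
    simp_rw [e]
    rw [lintegral_const_mul _ (by fun_prop), lintegral_exp_quadratic (by positivity),
      ← ENNReal.ofReal_mul hK0, ← ENNReal.ofReal_mul (by positivity), hroot, ← mul_assoc K]
    congr 3
    field_simp
    ring
  rw [lintegral_withDensity_eq_lintegral_mul _ hpdf.ennreal_ofReal (by fun_prop),
    Measure.volume_eq_prod, lintegral_prod _ (by fun_prop)]
  simp only [Pi.mul_apply]
  simp_rw [hin]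
  rw [lintegral_const_mul _ (by fun_prop), lintegral_exp_quadratic (by positivity),
    ← ENNReal.ofReal_mul (by positivity), ← mul_assoc]
  congr 2
  · rw [show Real.pi / ((1 - (1 + ρ) * τ) * (1 + (1 - ρ) * τ) / (2 * σX ^ 2)) =
        (2 * Real.pi) * σX ^ 2 / ((1 - (1 + ρ) * τ) * (1 + (1 - ρ) * τ)) by field_simp,
        Real.sqrt_div (by positivity), Real.sqrt_mul (by positivity) (σX ^ 2), Real.sqrt_sq hσX.le,
        Real.sqrt_mul (by positivity) (1 - ρ ^ 2)]
    have : 0 < √(1 - ρ ^ 2) := by positivity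
    have hπ : √(2 * Real.pi) * √(2 * Real.pi) = 2 * Real.pi := Real.mul_self_sqrt (by positivity)
    have := Real.sqrt_pos.2 hQ
    generalize √((1 - (1 + ρ) * τ) * (1 + (1 - ρ) * τ)) = q at this ⊢
    rw [hK]
    field_simp
    linear_combination hπ
  · congr 1
    field_simp
    ring

lemma isProbabilityMeasure_biNormPDF :
    IsProbabilityMeasure ((volume : Measure (ℝ × ℝ)).withDensity
      fun v => ENNReal.ofReal (biNormPDF μX μY σX σY ρ v)) := by
  have h := lintegral_exp_mul_biNormPDF (μX := μX) (μY := μY) hσX hσY hρ₁ hρ₂ (τ := 0)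
    (by simp) (by simp)
  exact ⟨by simpa using h⟩

/-- The law of a sum of products of correlated normal variables is that of a scaled difference of
independent noncentral gamma variables. -/
lemma prodLaw_eq_map_ncGamma {n : ℕ} (hn : 1 ≤ n) :
    prodLaw μX μY σX σY ρ n =
      ((ncGamma (n / 2) (n * (μX / σX + μY / σY) ^ 2 / (4 * (1 + ρ))) (1 / (1 + ρ))).prod
        (ncGamma (n / 2) (n * (μX / σX - μY / σY) ^ 2 / (4 * (1 - ρ))) (1 / (1 - ρ)))).map
        fun v => σX * σY * (v.1 - v.2) := by
  have hθ : 0 < 1 + ρ := by linarith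
  have hκ : 0 < 1 - ρ := by linarith
  have ha : (0:ℝ) < n / 2 := by have : (1:ℝ) ≤ n := by exact_mod_cast hn
                                positivity
  have hL₁ : 0 ≤ n * (μX / σX + μY / σY) ^ 2 / (4 * (1 + ρ)) := by positivity
  have hL₂ : 0 ≤ n * (μX / σX - μY / σY) ^ 2 / (4 * (1 - ρ)) := by positivity
  have hr₁ : 0 < 1 / (1 + ρ) := by positivity
  have hr₂ : 0 < 1 / (1 - ρ) := by positivity
  have := isProbabilityMeasure_biNormPDF (μX := μX) (μY := μY) hσX hσY hρ₁ hρ₂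
  have := isProbabilityMeasure_ncGamma ha hL₁ hr₁
  have := isProbabilityMeasure_ncGamma ha hL₂ hr₂
  set δ := min (1 / (1 + ρ)) (1 / (1 - ρ)) / (σX * σY) with hδ
  have hδ0 : 0 < δ := by positivity
  have htτ : ∀ t ∈ Set.Ioo (-δ) δ,
      t * (σX * σY) < 1 / (1 + ρ) ∧ -(t * (σX * σY)) < 1 / (1 - ρ) := by
    intro t ht
    have h1 : t * (σX * σY) < min (1 / (1 + ρ)) (1 / (1 - ρ)) :=
      (lt_div_iff₀ (by positivity)).1 ht.2
    have h2 : -t * (σX * σY) < min (1 / (1 + ρ)) (1 / (1 - ρ)) :=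
      (lt_div_iff₀ (by positivity)).1 (by linarith [ht.1])
    exact ⟨h1.trans_le (min_le_left _ _), by linarith [h2.trans_le (min_le_right _ _)]⟩
  have hexp : ∀ (t : ℝ) (v : Fin n → ℝ × ℝ), Real.exp (t * ∑ i, (v i).1 * (v i).2) =
      ∏ i, Real.exp (t * ((v i).1 * (v i).2)) := fun t v => by
    rw [Finset.mul_sum, Real.exp_sum]
  have hexp' : ∀ (t : ℝ) (v : ℝ × ℝ), Real.exp (t * (σX * σY * (v.1 - v.2))) =
      Real.exp (t * (σX * σY) * v.1) * Real.exp (-(t * (σX * σY)) * v.2) := fun t v => by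
    rw [← Real.exp_add]; ring_nf
  have hmap : Measurable fun v : Fin n → ℝ × ℝ => ∑ i, (v i).1 * (v i).2 := by fun_prop
  have hone : ∀ t ∈ Set.Ioo (-δ) δ, 0 < 1 - (1 + ρ) * (t * (σX * σY)) ∧
      0 < 1 + (1 - ρ) * (t * (σX * σY)) := by
    intro t ht
    obtain ⟨h1, h2⟩ := htτ t ht
    rw [lt_div_iff₀ hθ] at h1
    rw [lt_div_iff₀ hκ] at h2
    constructor <;> linarith
  have hpair : ∀ t ∈ Set.Ioo (-δ) δ, ∫⁻ v, ENNReal.ofReal (Real.exp (t * (v.1 * v.2)))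
      ∂((volume : Measure (ℝ × ℝ)).withDensity
        fun v => ENNReal.ofReal (biNormPDF μX μY σX σY ρ v)) =
      ENNReal.ofReal ((√((1 - (1 + ρ) * (t * (σX * σY))) * (1 + (1 - ρ) * (t * (σX * σY)))))⁻¹ *
        Real.exp (((μX / σX + (t * (σX * σY)) * (μY / σY - ρ * (μX / σX))) ^ 2) /
          (2 * ((1 - (1 + ρ) * (t * (σX * σY))) * (1 + (1 - ρ) * (t * (σX * σY))))) -
          (μX / σX) ^ 2 / 2)) := fun t ht => by
    have h := lintegral_exp_mul_biNormPDF (μX := μX) (μY := μY) hσX hσY hρ₁ hρ₂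
      (hone t ht).1 (hone t ht).2
    rwa [mul_div_cancel_right₀ _ (by positivity)] at h
  have hint : ∀ t ∈ Set.Ioo (-δ) δ, Integrable (fun v : ℝ × ℝ => Real.exp (t * (v.1 * v.2)))
      ((volume : Measure (ℝ × ℝ)).withDensity
        fun v => ENNReal.ofReal (biNormPDF μX μY σX σY ρ v)) := fun t ht => by
    refine ⟨by fun_prop, ?_⟩
    rw [hasFiniteIntegral_iff_ofReal (ae_of_all _ fun _ => (Real.exp_pos _).le), hpair t ht]
    exact ENNReal.ofReal_lt_top
  have : IsProbabilityMeasure (prodLaw μX μY σX σY ρ n) :=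
    Measure.isProbabilityMeasure_map hmap.aemeasurable
  have := Measure.isProbabilityMeasure_map (f := fun v : ℝ × ℝ => σX * σY * (v.1 - v.2))
    (μ := (ncGamma (n / 2) (n * (μX / σX + μY / σY) ^ 2 / (4 * (1 + ρ))) (1 / (1 + ρ))).prod
        (ncGamma (n / 2) (n * (μX / σX - μY / σY) ^ 2 / (4 * (1 - ρ))) (1 / (1 - ρ))))
    (by fun_prop)
  refine ext_of_mgf_eq_near_zero hδ0 (fun t ht => ?_) (fun t ht => ?_) (fun t ht => ?_)
  · rw [prodLaw, integrable_map_measure (by fun_prop) hmap.aemeasurable]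
    simp only [Function.comp_def, hexp]
    exact Integrable.fintype_prod fun _ => hint t ht
  · rw [integrable_map_measure (by fun_prop) (by fun_prop)]
    simp only [Function.comp_def, hexp']
    exact (integrable_exp_ncGamma ha hL₁ hr₁ (htτ t ht).1).mul_prod
      (integrable_exp_ncGamma ha hL₂ hr₂ (htτ t ht).2)
  · rw [prodLaw, integral_map hmap.aemeasurable (by fun_prop),
      integral_map (by fun_prop) (by fun_prop)]
    simp only [hexp, hexp']
    rw [integral_fintype_prod_eq_pow (ι := Fin n) (fun v : ℝ × ℝ => Real.exp (t * (v.1 * v.2))),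
      integral_prod_mul (fun v => Real.exp (t * (σX * σY) * v))
        (fun v => Real.exp (-(t * (σX * σY)) * v)),
      integral_exp_ncGamma ha hL₁ hr₁ (htτ t ht).1, integral_exp_ncGamma ha hL₂ hr₂ (htτ t ht).2,
      integral_eq_lintegral_of_nonneg_ae (ae_of_all _ fun _ => (Real.exp_pos _).le) (by fun_prop),
      hpair t ht, ENNReal.toReal_ofReal (by positivity), Fintype.card_fin]
    obtain ⟨h1, h2⟩ := hone t ht
    generalize t * (σX * σY) = τ at h1 h2 ⊢
    have e1 : 1 / (1 + ρ) / (1 / (1 + ρ) - τ) = (1 - (1 + ρ) * τ)⁻¹ := by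
      have : 1 / (1 + ρ) - τ = (1 - (1 + ρ) * τ) / (1 + ρ) := by field_simp
      rw [this]; field_simp
    have e2 : 1 / (1 - ρ) / (1 / (1 - ρ) - -τ) = (1 + (1 - ρ) * τ)⁻¹ := by
      have : 1 / (1 - ρ) - -τ = (1 + (1 - ρ) * τ) / (1 - ρ) := by field_simp; ring
      rw [this]; field_simp
    have e3 : τ / (1 / (1 + ρ) - τ) = (1 + ρ) * τ / (1 - (1 + ρ) * τ) := by
      have : 1 / (1 + ρ) - τ = (1 - (1 + ρ) * τ) / (1 + ρ) := by field_simp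
      rw [this]; field_simp
    have e4 : -τ / (1 / (1 - ρ) - -τ) = -((1 - ρ) * τ / (1 + (1 - ρ) * τ)) := by
      have : 1 / (1 - ρ) - -τ = (1 + (1 - ρ) * τ) / (1 - ρ) := by field_simp; ring
      rw [this]; field_simp
    rw [e1, e2, e3, e4, mul_pow, inv_pow, ← Real.exp_nat_mul, Real.sqrt_eq_rpow,
      ← Real.rpow_natCast (_ ^ (_:ℝ)), ← Real.rpow_mul (mul_pos h1 h2).le,
      Real.mul_rpow h1.le h2.le, mul_inv, ← Real.inv_rpow h1.le, ← Real.inv_rpow h2.le,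
      mul_mul_mul_comm, ← Real.exp_add, show (1:ℝ) / 2 * n = n / 2 by ring]
    congr 2
    generalize μX / σX = u
    generalize μY / σY = v
    clear e1 e2 e3 e4
    generalize hP : 1 - (1 + ρ) * τ = P at h1 ⊢
    generalize hQ : 1 + (1 - ρ) * τ = Q at h2 ⊢
    field_simp
    rw [← hP, ← hQ]
    ring

end ProductLaw

/-- The density of a noncentral gamma law. -/
def ncGammaDensity (a L r w : ℝ) : ℝ :=
  Real.exp (-L) * r ^ a * w ^ (a - 1) * Real.exp (-(r * w)) * hypH a (2 * √(L * r * w))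

lemma measurable_ncGammaDensity {a : ℝ} (ha : 0 < a) (L r : ℝ) :
    Measurable (ncGammaDensity a L r) := by
  have := (measurable_hypH ha).comp (g := hypH a) (f := fun w => 2 * √(L * r * w)) (by fun_prop)
  unfold ncGammaDensity
  exact Measurable.mul (by fun_prop) this

lemma setLIntegral_Ioi_add (f : ℝ → ENNReal) (c y : ℝ) :
    ∫⁻ w in Set.Ioi (c + y), f w = ∫⁻ w in Set.Ioi c, f (w + y) := by
  have := (measurePreserving_add_right volume y).setLIntegral_comp_preimage_emb
    (measurableEmbedding_addRight y) f (Set.Ioi (c + y))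
  rw [← this]
  congr 2
  ext; simp

lemma integral_Ioi_sq (g : ℝ → ℝ) {t : ℝ} (ht : 0 ≤ t) :
    ∫ w in Set.Ioi (t ^ 2), g w = ∫ τ in Set.Ioi t, 2 * τ * g (τ ^ 2) := by
  have himg : (fun τ : ℝ => τ ^ 2) '' Set.Ioi t = Set.Ioi (t ^ 2) := by
    ext w
    simp only [Set.mem_image, Set.mem_Ioi]
    constructor
    · rintro ⟨τ, hτ, rfl⟩; gcongr
    · intro hw
      exact ⟨√w, Real.lt_sqrt_of_sq_lt hw, Real.sq_sqrt ((sq_nonneg t).trans hw.le)⟩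
  have hinj : Set.InjOn (fun τ : ℝ => τ ^ 2) (Set.Ioi t) := fun x hx y hy h =>
    (pow_left_inj₀ (ht.trans (le_of_lt hx)) (ht.trans (le_of_lt hy)) two_ne_zero).1 h
  rw [← himg, integral_image_eq_integral_abs_deriv_smul measurableSet_Ioi
    (f' := fun τ => 2 * τ) (fun τ _ => by simpa using (hasDerivAt_pow 2 τ).hasDerivWithinAt) hinj]
  refine setIntegral_congr_fun measurableSet_Ioi fun τ hτ => ?_
  have : 0 ≤ 2 * τ := by have : t < τ := hτ; linarith
  simp [abs_of_nonneg this]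

lemma ncGamma_prod_sub_tail {a L₁ r₁ L₂ r₂ : ℝ} (ha : 0 < a) (hL₁ : 0 ≤ L₁) (hr₁ : 0 < r₁)
    (hL₂ : 0 ≤ L₂) (hr₂ : 0 < r₂) {t : ℝ} (ht : 0 ≤ t) :
    (((ncGamma a L₁ r₁).prod (ncGamma a L₂ r₂)) {v | t ^ 2 < v.1 - v.2}).toReal =
      ∫ τ in Set.Ioi t, 2 * τ * ∫ b, ncGammaDensity a L₁ r₁ (τ ^ 2 + b) ∂ncGamma a L₂ r₂ := by
  have := isProbabilityMeasure_ncGamma ha hL₁ hr₁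
  have := isProbabilityMeasure_ncGamma ha hL₂ hr₂
  have hd := measurable_ncGammaDensity ha L₁ r₁
  have hS : MeasurableSet {v : ℝ × ℝ | t ^ 2 < v.1 - v.2} :=
    measurableSet_lt measurable_const (by fun_prop)
  have hmeas : Measurable fun p : ℝ × ℝ => ENNReal.ofReal (ncGammaDensity a L₁ r₁ (p.2 + p.1)) :=
    (hd.comp (by fun_prop)).ennreal_ofReal
  have htail : ((ncGamma a L₁ r₁).prod (ncGamma a L₂ r₂)) {v | t ^ 2 < v.1 - v.2} =
      ∫⁻ w in Set.Ioi (t ^ 2), ∫⁻ b, ENNReal.ofReal (ncGammaDensity a L₁ r₁ (w + b))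
        ∂ncGamma a L₂ r₂ := by
    rw [Measure.prod_apply_symm hS, lintegral_lintegral_swap
      (f := fun w b => ENNReal.ofReal (ncGammaDensity a L₁ r₁ (w + b)))
      (hmeas.comp measurable_swap).aemeasurable]
    refine lintegral_congr_ae ?_
    filter_upwards [ae_ncGamma_pos a L₂ r₂] with b hb
    have : (fun x => (x, b)) ⁻¹' {v : ℝ × ℝ | t ^ 2 < v.1 - v.2} = Set.Ioi (t ^ 2 + b) := by
      ext x; simp [lt_sub_iff_add_lt]
    rw [this, ncGamma_Ioi ha hL₁ hr₁ (by positivity), setLIntegral_Ioi_add]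
    rfl
  have hfin : ∫⁻ w in Set.Ioi (t ^ 2), ∫⁻ b, ENNReal.ofReal (ncGammaDensity a L₁ r₁ (w + b))
        ∂ncGamma a L₂ r₂ ≠ ⊤ := htail ▸ measure_ne_top _ _
  have hm : Measurable fun w => ∫⁻ b, ENNReal.ofReal (ncGammaDensity a L₁ r₁ (w + b))
        ∂ncGamma a L₂ r₂ := (hmeas.comp measurable_swap).lintegral_prod_right'
  rw [htail, ← integral_toReal hm.aemeasurable (ae_lt_top' hm.aemeasurable hfin),
    ← integral_Ioi_sq (fun w => ∫ b, ncGammaDensity a L₁ r₁ (w + b) ∂ncGamma a L₂ r₂) ht]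
  refine setIntegral_congr_fun measurableSet_Ioi fun w hw => ?_
  have hw : 0 < w := (by positivity : 0 ≤ t ^ 2).trans_lt hw
  have hd' : Measurable fun b => ncGammaDensity a L₁ r₁ (w + b) := hd.comp (by fun_prop)
  rw [integral_eq_lintegral_of_nonneg_ae _ hd'.aestronglyMeasurable]
  filter_upwards [ae_ncGamma_pos a L₂ r₂] with b hb
  have := hypH_nonneg ha (2 * √(L₁ * r₁ * (w + b)))
  simp only [Pi.zero_apply, ncGammaDensity]
  positivity

lemma exists_one_add_pow_le_exp (M : ℕ) {ε : ℝ} (hε : 0 < ε) :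
    ∃ C, ∀ b : ℝ, 0 < b → (1 + b) ^ M ≤ C * Real.exp (ε * b) := by
  refine ⟨Nat.factorial M / ε ^ M * Real.exp ε, fun b hb => ?_⟩
  have h := Real.pow_div_factorial_le_exp (ε * (1 + b)) (by positivity) M
  rw [div_le_iff₀ (by positivity), mul_pow] at h
  calc (1 + b) ^ M = ε ^ M * (1 + b) ^ M / ε ^ M := by field_simp
    _ ≤ Real.exp (ε * (1 + b)) * Nat.factorial M / ε ^ M := by gcongr
    _ = _ := by rw [mul_add, mul_one, Real.exp_add]; ring

/-- The noncentral gamma law tilted by `exp (-τ b)`. -/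
def ncGammaTilt (a L r τ : ℝ) : Measure ℝ :=
  (ncGamma a L r).withDensity fun b => ENNReal.ofReal (Real.exp (-τ * b))

lemma integral_ncGammaTilt (a L r τ : ℝ) (f : ℝ → ℝ) :
    ∫ b, f b ∂ncGammaTilt a L r τ = ∫ b, Real.exp (-τ * b) * f b ∂ncGamma a L r := by
  rw [ncGammaTilt, integral_withDensity_eq_integral_toReal_smul (by fun_prop)
    (ae_of_all _ fun _ => ENNReal.ofReal_lt_top)]
  simp [ENNReal.toReal_ofReal (Real.exp_pos _).le]

lemma ae_ncGammaTilt_pos (a L r τ : ℝ) : ∀ᵐ w ∂ncGammaTilt a L r τ, 0 < w :=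
  (withDensity_absolutelyContinuous _ _).ae_le (ae_ncGamma_pos a L r)

lemma integrable_ncGammaTilt {a L r τ : ℝ} (ha : 0 < a) (hL : 0 ≤ L) (hr : 0 < r) (hτ : 0 < τ)
    {β : ℝ} (M : ℕ) :
    Integrable (fun b => (1 + b) ^ M * Real.exp (β * √b)) (ncGammaTilt a L r τ) := by
  have := isProbabilityMeasure_ncGamma ha hL hr
  rw [ncGammaTilt, integrable_withDensity_iff_integrable_smul' (by fun_prop)
    (ae_of_all _ fun _ => ENNReal.ofReal_lt_top)]
  simp only [ENNReal.toReal_ofReal (Real.exp_pos _).le, smul_eq_mul]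
  obtain ⟨C, hC⟩ := exists_one_add_pow_le_exp M (half_pos hτ)
  refine (integrable_const (C * Real.exp (β ^ 2 / (2 * τ)))).mono' (by fun_prop) ?_
  filter_upwards [ae_ncGamma_pos a L r] with b hb
  rw [Real.norm_of_nonneg (by positivity)]
  have h := hC b hb
  have h0 : 0 ≤ C * Real.exp (τ / 2 * b) := le_trans (by positivity) h
  have hs := Real.sq_sqrt hb.le
  have h2 : β * √b ≤ τ / 2 * b + β ^ 2 / (2 * τ) := by
    rw [← sub_nonneg]
    have : τ / 2 * b + β ^ 2 / (2 * τ) - β * √b = (τ * √b - β) ^ 2 / (2 * τ) := by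
      field_simp
      linear_combination (-τ ^ 2) * hs
    rw [this]; positivity
  calc _ ≤ Real.exp (-τ * b) * ((C * Real.exp (τ / 2 * b)) *
        Real.exp (τ / 2 * b + β ^ 2 / (2 * τ))) := by gcongr
    _ = C * Real.exp (-τ * b + τ / 2 * b + (τ / 2 * b + β ^ 2 / (2 * τ))) := by
        rw [Real.exp_add (-τ * b + τ / 2 * b), Real.exp_add (-τ * b)]; ring
    _ = _ := by congr 2; ring

/-- The exponent `w ^ ((n - 1) / 2) exp (-w)` is divided out of `hypH (n / 2)` to extract its
growth. -/
lemma ncGammaDensity_sq_add {n : ℕ} {θ b : ℝ} (hθ : 0 < θ) (hb : 0 < b) {t y : ℝ} (ht : 0 < t)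
    (hy : 0 < y) :
    2 * t * ncGammaDensity (n / 2) (b ^ 2 / θ) (1 / θ) (t ^ 2 + y) =
      2 * (Real.exp (-(b ^ 2 / θ)) * (1 / θ) ^ ((n:ℝ) / 2) *
        (2 * b / θ) ^ (-(((n:ℝ) - 1) / 2))) *
      (t ^ (((n:ℝ) - 1) / 2) * Real.exp (-t ^ 2 / θ + 2 * b / θ * t)) *
      (Real.exp (-(1 / θ) * y) * ((1 + y / t ^ 2) ^ (((n:ℝ) - 3) / 4) *
        Real.exp (2 * b / θ * (√(t ^ 2 + y) - t)) *
        ((2 * b / θ * √(t ^ 2 + y)) ^ (((n:ℝ) - 1) / 2) *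
          Real.exp (-(2 * b / θ * √(t ^ 2 + y))) * hypH (n / 2) (2 * b / θ * √(t ^ 2 + y))))) := by
  have hw : 0 < t ^ 2 + y := by positivity
  have e1 : 2 * √(b ^ 2 / θ * (1 / θ) * (t ^ 2 + y)) = 2 * b / θ * √(t ^ 2 + y) := by
    rw [show b ^ 2 / θ * (1 / θ) * (t ^ 2 + y) = (b / θ) ^ 2 * (t ^ 2 + y) by field_simp,
      Real.sqrt_mul (by positivity), Real.sqrt_sq (by positivity)]
    ring
  have e2 : Real.exp (-(1 / θ * (t ^ 2 + y))) = Real.exp (-t ^ 2 / θ + 2 * b / θ * t) *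
      Real.exp (-(1 / θ) * y) * Real.exp (2 * b / θ * (√(t ^ 2 + y) - t)) *
      Real.exp (-(2 * b / θ * √(t ^ 2 + y))) := by
    rw [← Real.exp_add, ← Real.exp_add, ← Real.exp_add]
    congr 1; ring
  have e3 : (1 + y / t ^ 2) = (t ^ 2 + y) * (t ^ 2)⁻¹ := by field_simp
  have e4 : t * (t ^ 2 + y) ^ ((n:ℝ) / 2 - 1) = (2 * b / θ) ^ (-(((n:ℝ) - 1) / 2)) *
      t ^ (((n:ℝ) - 1) / 2) * (1 + y / t ^ 2) ^ (((n:ℝ) - 3) / 4) *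
      (2 * b / θ * √(t ^ 2 + y)) ^ (((n:ℝ) - 1) / 2) := by
    have hβ : 0 < 2 * b / θ := by positivity
    have hsq : t ^ 2 = t ^ (2:ℝ) := (Real.rpow_two t).symm
    rw [e3, Real.mul_rpow hw.le (by positivity), Real.mul_rpow hβ.le (by positivity),
      Real.rpow_neg hβ.le, Real.sqrt_eq_rpow, ← Real.rpow_mul hw.le, Real.inv_rpow (by positivity)]
    generalize t ^ 2 + y = w at hw ⊢
    rw [hsq, ← Real.rpow_mul ht.le, ← Real.rpow_neg ht.le,
      show (n:ℝ) / 2 - 1 = ((n:ℝ) - 3) / 4 + 1 / 2 * (((n:ℝ) - 1) / 2) by ring, Real.rpow_add hw]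
    have e5 : t ^ (((n:ℝ) - 1) / 2) * t ^ (-(2 * (((n:ℝ) - 3) / 4))) = t := by
      rw [← Real.rpow_add ht]
      convert Real.rpow_one t using 2
      ring
    have := Real.rpow_pos_of_pos hβ (((n:ℝ) - 1) / 2)
    generalize t ^ (-(2 * (((n:ℝ) - 3) / 4))) = T at e5 ⊢
    field_simp
    linear_combination -e5
  rw [ncGammaDensity, e1, e2]
  linear_combination 2 * Real.exp (-(b ^ 2 / θ)) * (1 / θ) ^ ((n:ℝ) / 2) *
    (Real.exp (-t ^ 2 / θ + 2 * b / θ * t) *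
      Real.exp (-(1 / θ) * y) * Real.exp (2 * b / θ * (√(t ^ 2 + y) - t)) *
      Real.exp (-(2 * b / θ * √(t ^ 2 + y)))) * hypH (n / 2) (2 * b / θ * √(t ^ 2 + y)) * e4

lemma tailCoef_const_mul (θ m b C : ℝ) (c : ℕ → ℝ) (p : ℕ) :
    tailCoef θ m b (fun l => C * c l) p = C * tailCoef θ m b c p := by
  simp only [tailCoef, mul_assoc C, ← Finset.mul_sum]

/-- The expansion coefficients of the tilted average defining the density of a difference of
noncentral gamma variables. -/
def densityCoef (n : ℕ) (θ b L r : ℝ) (p : ℕ) : ℝ :=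
  ∑ k ∈ range (p + 1), 2 ^ ((n:ℝ) / 2 - 3 / 2) / √Real.pi *
    (poch ((3 - (n:ℝ)) / 2) k * poch (((n:ℝ) - 1) / 2) k / (Nat.factorial k * 2 ^ k)) *
    (2 * b / θ)⁻¹ ^ k *
    ∑ i ∈ Icc ((p - k + 1) / 2) (p - k),
      (Real.exp (-L) * (r / (r + 1 / θ)) ^ ((n:ℝ) / 2) * (r + 1 / θ)⁻¹ ^ i * poch (n / 2) i *
        hypM (n / 2 + i) (n / 2) (L * (r / (r + 1 / θ)))) *
      puiseuxG (((n:ℝ) - 3) / 4 - k / 2) (2 * b / θ) i (p - k)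

lemma asympExp_ncGamma_prod_sub_tail {n : ℕ} (hn : 1 ≤ n) {θ b L r : ℝ} (hθ : 0 < θ) (hb : 0 < b)
    (hL : 0 ≤ L) (hr : 0 < r) :
    AsympExp (fun t => t ^ (1 - ((n:ℝ) - 1) / 2) * Real.exp (t ^ 2 / θ - 2 * b / θ * t) *
        (((ncGamma (n / 2) (b ^ 2 / θ) (1 / θ)).prod (ncGamma (n / 2) L r))
          {v | t ^ 2 < v.1 - v.2}).toReal)
      (fun p => 2 * (Real.exp (-(b ^ 2 / θ)) * (1 / θ) ^ ((n:ℝ) / 2) *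
        (2 * b / θ) ^ (-(((n:ℝ) - 1) / 2))) *
        tailCoef θ (((n:ℝ) - 1) / 2) b (densityCoef n θ b L r) p) := by
  have ha : (0:ℝ) < n / 2 := by
    have : (1:ℝ) ≤ n := by exact_mod_cast hn
    positivity
  have hβ : 0 < 2 * b / θ := by positivity
  have := isProbabilityMeasure_ncGamma ha hL hr
  have hH : Measurable fun z : ℝ => z ^ (((n:ℝ) - 1) / 2) * Real.exp (-z) * hypH (n / 2) z :=
    Measurable.mul (by fun_prop) (measurable_hypH ha)
  have hexp := asympExp_integral_bessel (ae_ncGammaTilt_pos (n / 2) L r (1 / θ)) hβ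
    (fun M => integrable_ncGammaTilt ha hL hr (by positivity) M) (((n:ℝ) - 3) / 4) hH
    (asympExp_hypH_nat hn)
  have hφ := hexp.const_mul (2 * (Real.exp (-(b ^ 2 / θ)) * (1 / θ) ^ ((n:ℝ) / 2) *
        (2 * b / θ) ^ (-(((n:ℝ) - 1) / 2))))
  have hmeas : Measurable fun t : ℝ => ∫ y, (1 + y / t ^ 2) ^ (((n:ℝ) - 3) / 4) *
      Real.exp (2 * b / θ * (√(t ^ 2 + y) - t)) *
        ((2 * b / θ * √(t ^ 2 + y)) ^ (((n:ℝ) - 1) / 2) *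
          Real.exp (-(2 * b / θ * √(t ^ 2 + y))) * hypH (n / 2) (2 * b / θ * √(t ^ 2 + y)))
      ∂ncGammaTilt (n / 2) L r (1 / θ) := by
    have : SFinite (ncGammaTilt (n / 2) L r (1 / θ)) := by unfold ncGammaTilt; infer_instance
    refine (StronglyMeasurable.integral_prod_right' (f := fun p : ℝ × ℝ =>
      (1 + p.2 / p.1 ^ 2) ^ (((n:ℝ) - 3) / 4) *
      Real.exp (2 * b / θ * (√(p.1 ^ 2 + p.2) - p.1)) *
        ((2 * b / θ * √(p.1 ^ 2 + p.2)) ^ (((n:ℝ) - 1) / 2) *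
          Real.exp (-(2 * b / θ * √(p.1 ^ 2 + p.2))) *
          hypH (n / 2) (2 * b / θ * √(p.1 ^ 2 + p.2)))) ?_).measurable
    exact (Measurable.mul (by fun_prop) (hH.comp (by fun_prop))).stronglyMeasurable
  have htail := asympExp_tail hθ (((n:ℝ) - 1) / 2) b hφ (hmeas.const_mul _)
  refine (htail.congr' ?_).congr_coeff fun p => ?_
  · filter_upwards [eventually_gt_atTop 0] with t ht
    rw [ncGamma_prod_sub_tail ha (by positivity) (by positivity) hL hr ht.le]
    congr 1
    refine setIntegral_congr_fun measurableSet_Ioi fun τ hτ => ?_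
    have hτ0 : 0 < τ := ht.trans hτ
    rw [integral_ncGammaTilt, ← integral_const_mul, ← integral_const_mul, ← integral_const_mul]
    refine integral_congr_ae ?_
    filter_upwards [ae_ncGamma_pos (n / 2) L r] with y hy
    rw [ncGammaDensity_sq_add hθ hb hτ0 hy]
    ring
  · rw [tailCoef_const_mul]
    congr 2
    funext p
    refine Finset.sum_congr rfl fun k _ => ?_
    congr 1
    refine Finset.sum_congr rfl fun i _ => ?_
    rw [integral_ncGammaTilt]
    simp_rw [mul_comm (Real.exp _)]
    rw [integral_ncGamma_pow_mul_exp ha hL hr i (by linarith [show 0 < 1 / θ by positivity])]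
    rw [sub_neg_eq_add]
    ring

lemma puiseuxG_zero_zero (a b : ℝ) : puiseuxG a b 0 0 = 1 := by
  simp [puiseuxG, compS, genBinom]

lemma cCoef_eq {rX rY ρ : ℝ} {n : ℕ} (hn : 1 ≤ n) (ℓ : ℕ) :
    cCoef rX rY ρ n ℓ = Real.exp (-((n : ℝ) / 8 * ((1 + ρ) / (1 - ρ)) * (rX - rY) ^ 2)) *
      ∑ j ∈ range (ℓ + 1), hCoef rX rY ρ n j ℓ := by
  have ha : (0:ℝ) < n / 2 := by
    have : (1:ℝ) ≤ n := by exact_mod_cast hn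
    positivity
  rcases eq_or_ne ℓ 0 with rfl | h
  · simp [cCoef, hCoef, poch, puiseuxG_zero_zero, hypM_self ha, ← Real.exp_add]
  · rw [cCoef, if_neg h]

lemma densityCoef_eq {rX rY ρ : ℝ} {n : ℕ} (hn : 1 ≤ n) (hρ₁ : -1 < ρ) (hρ₂ : ρ < 1)
    (hsum : rX + rY ≠ 0) (p : ℕ) :
    densityCoef n (1 + ρ) (|rX + rY| * √n / 2) (n * (rX - rY) ^ 2 / (4 * (1 - ρ))) (1 / (1 - ρ)) p =
      2 ^ ((n:ℝ) / 2 - 3 / 2) / √Real.pi * ((1 + ρ) / 2) ^ ((n:ℝ) / 2) *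
        Real.exp (-(n * (rX - rY) ^ 2 / (4 * (1 - ρ)))) *
        Real.exp ((n : ℝ) / 8 * ((1 + ρ) / (1 - ρ)) * (rX - rY) ^ 2) * cCoef rX rY ρ n p := by
  have hθ : 0 < 1 + ρ := by linarith
  have hκ : 0 < 1 - ρ := by linarith
  have hn0 : (0:ℝ) < n := by exact_mod_cast hn
  have hR : 0 < |rX + rY| := abs_pos.2 hsum
  have e0 : 1 / (1 - ρ) + 1 / (1 + ρ) = 2 / (1 - ρ ^ 2) := by
    rw [show 1 - ρ ^ 2 = (1 - ρ) * (1 + ρ) by ring]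
    field_simp; ring
  have e1 : 1 / (1 - ρ) / (1 / (1 - ρ) + 1 / (1 + ρ)) = (1 + ρ) / 2 := by
    rw [e0, show 1 - ρ ^ 2 = (1 - ρ) * (1 + ρ) by ring]
    field_simp
  have e2 : n * (rX - rY) ^ 2 / (4 * (1 - ρ)) * ((1 + ρ) / 2) =
      (n : ℝ) / 8 * ((1 + ρ) / (1 - ρ)) * (rX - rY) ^ 2 := by
    field_simp; ring
  have e3 : 2 * (|rX + rY| * √n / 2) / (1 + ρ) = |rX + rY| / (1 + ρ) * √n := by ring
  rw [cCoef_eq hn, mul_assoc, ← mul_assoc (Real.exp _) (Real.exp _), ← Real.exp_add,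
    add_neg_cancel, Real.exp_zero, one_mul, densityCoef, ← Finset.sum_range_reflect, Finset.mul_sum]
  have e4 : (1 / (1 - ρ) + 1 / (1 + ρ))⁻¹ = (1 - ρ ^ 2) / 2 := by rw [e0, inv_div]
  refine Finset.sum_congr rfl fun j hj => ?_
  have hj : j ≤ p := by simpa [Nat.lt_succ_iff] using hj
  have h1 : p + 1 - 1 - j = p - j := by omega
  have h2 : p - (p - j) = j := by omega
  rw [h1, h2, hCoef, e1, e2, e3, e4]
  have e5 : (|rX + rY| / (1 + ρ) * √n)⁻¹ ^ (p - j) =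
      ((1 + ρ) / |rX + rY|) ^ (p - j) / (n:ℝ) ^ (((p - j : ℕ):ℝ) / 2) := by
    have : (n:ℝ) ^ (((p - j : ℕ):ℝ) / 2) = √n ^ (p - j) := by
      rw [Real.sqrt_eq_rpow, ← Real.rpow_natCast, ← Real.rpow_mul hn0.le]
      congr 1; ring
    rw [this, ← div_pow, mul_inv, inv_div, div_eq_mul_inv _ (√(n:ℝ))]
  rw [e5]
  simp only [Finset.mul_sum]
  refine Finset.sum_congr rfl fun i _ => ?_
  field_simp

lemma tailCoef_eq {rX rY ρ : ℝ} {n : ℕ} (p : ℕ) :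
    tailCoef (1 + ρ) (((n:ℝ) - 1) / 2) (|rX + rY| * √n / 2) (cCoef rX rY ρ n) p =
      (1 + ρ) / 2 * gammaCoef rX rY ρ n p := by
  rcases eq_or_ne p 0 with rfl | hp
  · simp [tailCoef, gammaCoef, cCoef, genBinom, poch]
  rw [gammaCoef, if_neg hp, tailCoef]
  simp only [Finset.sum_mul, Finset.mul_sum, mul_ite, ite_mul, mul_zero, zero_mul]
  simp only [Finset.sum_sigma', ← Finset.sum_filter]
  refine Finset.sum_nbij' (fun x => ⟨p - x.1, x.2.2.1, x.2.1 - x.2.2.2, x.2.2.2⟩)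
    (fun x => ⟨p - x.1, x.2.2.1 + x.2.2.2, x.2.1, x.2.2.2⟩) ?_ ?_ ?_ ?_ ?_
  all_goals
    simp only [mem_sigma, mem_range, mem_filter]
    rintro ⟨r, q, j, l⟩ h
    dsimp only at h ⊢
  · omega
  · omega
  · have h1 : p - (p - r) = r := by omega
    have h2 : q - l + l = q := by omega
    rw [h1, h2]
  · have h1 : p - (p - r) = r := by omega
    have h2 : j + l - l = j := by omega
    rw [h1, h2]
  · obtain ⟨k, rfl⟩ : ∃ k, q = l + k := ⟨q - l, by omega⟩
    obtain ⟨i, rfl⟩ : ∃ i, p = r + i := ⟨p - r, by omega⟩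
    obtain rfl : r = l + k + 2 * j := by omega
    rw [show l + k - l = k by omega, show l + k + 2 * j + i - (l + k + 2 * j) = i by omega,
      neg_pow (|rX + rY| * √n / 2)]
    have h1 : ((n:ℝ) - 1) / 2 - 1 - (l + k + 2 * j : ℕ) = ((n:ℝ) - 3) / 2 - l - k - 2 * j := by
      push_cast; ring
    have h2 : (1 - (((n:ℝ) - 1) / 2 - (l + k : ℕ))) / 2 = ((l:ℝ) + k) / 2 - ((n:ℝ) - 3) / 4 := by
      push_cast; ring
    rw [h1, h2, pow_add, pow_add]
    ring

lemma prodLaw_Ioi {μX μY σX σY ρ : ℝ} {n : ℕ} (hσX : 0 < σX) (hσY : 0 < σY) (hρ₁ : -1 < ρ)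
    (hρ₂ : ρ < 1) (hn : 1 ≤ n) {x : ℝ} (hx : 0 < x) :
    prodLaw μX μY σX σY ρ n (Set.Ioi x) =
      ((ncGamma (n / 2) (n * (μX / σX + μY / σY) ^ 2 / (4 * (1 + ρ))) (1 / (1 + ρ))).prod
        (ncGamma (n / 2) (n * (μX / σX - μY / σY) ^ 2 / (4 * (1 - ρ))) (1 / (1 - ρ))))
        {v | √(x / (σX * σY)) ^ 2 < v.1 - v.2} := by
  have hs : 0 < σX * σY := mul_pos hσX hσY
  rw [prodLaw_eq_map_ncGamma hσX hσY hρ₁ hρ₂ hn, Measure.map_apply (by fun_prop) measurableSet_Ioi]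
  congr 1
  ext v
  simp [Real.sq_sqrt (div_pos hx hs).le, div_lt_iff₀ hs, mul_comm (σX * σY)]

lemma tail_constant_eq {rX rY ρ : ℝ} {n : ℕ} (hn : 1 ≤ n) (hρ₁ : -1 < ρ) (hρ₂ : ρ < 1)
    (hsum : rX + rY ≠ 0) :
    2 * (Real.exp (-((|rX + rY| * √n / 2) ^ 2 / (1 + ρ))) * (1 / (1 + ρ)) ^ ((n:ℝ) / 2) *
        (2 * (|rX + rY| * √n / 2) / (1 + ρ)) ^ (-(((n:ℝ) - 1) / 2))) *
      (2 ^ ((n:ℝ) / 2 - 3 / 2) / √Real.pi * ((1 + ρ) / 2) ^ ((n:ℝ) / 2) *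
        Real.exp (-(n * (rX - rY) ^ 2 / (4 * (1 - ρ)))) *
        Real.exp ((n : ℝ) / 8 * ((1 + ρ) / (1 - ρ)) * (rX - rY) ^ 2)) * ((1 + ρ) / 2) =
      (1 + ρ) * Real.exp (-((n : ℝ) * (rX ^ 2 + rY ^ 2 - 2 * ρ * rX * rY)) / (2 * (1 - ρ ^ 2))) /
          (2 * √(2 * Real.pi)) * ((1 + ρ) / (|rX + rY| * √n)) ^ (((n : ℝ) - 1) / 2) *
        Real.exp ((n : ℝ) / 8 * ((1 + ρ) / (1 - ρ)) * (rX - rY) ^ 2) := by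
  have hθ : 0 < 1 + ρ := by linarith
  have hκ : 0 < 1 - ρ := by linarith
  have hn0 : (0:ℝ) < n := by exact_mod_cast hn
  have hR : 0 < |rX + rY| := abs_pos.2 hsum
  have e1 : Real.exp (-((n : ℝ) * (rX ^ 2 + rY ^ 2 - 2 * ρ * rX * rY)) / (2 * (1 - ρ ^ 2))) =
      Real.exp (-((|rX + rY| * √n / 2) ^ 2 / (1 + ρ))) *
        Real.exp (-(n * (rX - rY) ^ 2 / (4 * (1 - ρ)))) := by
    rw [← Real.exp_add, div_pow, mul_pow, sq_abs, Real.sq_sqrt hn0.le,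
      show 1 - ρ ^ 2 = (1 - ρ) * (1 + ρ) by ring]
    congr 1
    field_simp
    ring
  have e2 : (2 * (|rX + rY| * √n / 2) / (1 + ρ)) ^ (-(((n:ℝ) - 1) / 2)) =
      ((1 + ρ) / (|rX + rY| * √n)) ^ (((n : ℝ) - 1) / 2) := by
    rw [Real.rpow_neg (by positivity), ← Real.inv_rpow (by positivity)]
    congr 1
    field_simp
  have e3 : (1 / (1 + ρ)) ^ ((n:ℝ) / 2) * ((1 + ρ) / 2) ^ ((n:ℝ) / 2) * 2 ^ ((n:ℝ) / 2 - 3 / 2) =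
      (2 * √2)⁻¹ := by
    rw [← Real.mul_rpow (by positivity) (by positivity),
      show 1 / (1 + ρ) * ((1 + ρ) / 2) = 2⁻¹ by field_simp, Real.inv_rpow (by norm_num),
      ← Real.rpow_neg (by norm_num), ← Real.rpow_add (by norm_num),
      show -((n:ℝ) / 2) + (n / 2 - 3 / 2) = -(1 + 1 / 2) by ring, Real.rpow_neg (by norm_num),
      Real.rpow_add (by norm_num), Real.rpow_one, Real.sqrt_eq_rpow]
  rw [e1, e2, Real.sqrt_mul (by norm_num)]
  generalize ((1 + ρ) / (|rX + rY| * √n)) ^ (((n : ℝ) - 1) / 2) = D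
  generalize Real.exp (-((|rX + rY| * √n / 2) ^ 2 / (1 + ρ))) = E1
  generalize Real.exp (-(n * (rX - rY) ^ 2 / (4 * (1 - ρ)))) = E2
  generalize Real.exp ((n : ℝ) / 8 * ((1 + ρ) / (1 - ρ)) * (rX - rY) ^ 2) = E3
  generalize (1 / (1 + ρ)) ^ ((n:ℝ) / 2) = A at e3 ⊢
  generalize ((1 + ρ) / 2) ^ ((n:ℝ) / 2) = B at e3 ⊢
  generalize (2:ℝ) ^ ((n:ℝ) / 2 - 3 / 2) = C at e3 ⊢
  calc _ = A * B * C * (E1 * D * E2 * E3 * (1 + ρ) / √Real.pi) := by ring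
    _ = _ := by rw [e3]; field_simp

lemma AsympExp.sub_isLittleO_comp {f : ℝ → ℝ} {c : ℕ → ℝ} (h : AsympExp f c) {s : ℝ} (hs : 0 < s)
    (N : ℕ) :
    (fun x : ℝ => f √(x / s) - ∑ p ∈ range (N + 1), c p * (s ^ ((p:ℝ) / 2) * x ^ (-(p:ℝ) / 2)))
      =o[atTop] fun x : ℝ => x ^ (-(N:ℝ) / 2) := by
  have ht : Tendsto (fun x : ℝ => √(x / s)) atTop atTop :=
    Real.tendsto_sqrt_atTop.comp (tendsto_id.atTop_div_const hs)
  have hpow : ∀ (p : ℕ) (x : ℝ), 0 < x →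
      (√(x / s))⁻¹ ^ p = s ^ ((p:ℝ) / 2) * x ^ (-(p:ℝ) / 2) := by
    intro p x hx
    rw [inv_pow, Real.sqrt_eq_rpow, ← Real.rpow_natCast, ← Real.rpow_mul (by positivity),
      Real.div_rpow hx.le hs.le, inv_div, neg_div, Real.rpow_neg hx.le, div_eq_mul_inv,
      show 1 / 2 * (p:ℝ) = p / 2 by ring]
  have h1 : (fun x : ℝ => f √(x / s) - ∑ p ∈ range (N + 1),
      c p * (s ^ ((p:ℝ) / 2) * x ^ (-(p:ℝ) / 2))) =O[atTop] fun x : ℝ => (√(x / s))⁻¹ ^ (N + 1) := by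
    refine ((h (N + 1)).comp_tendsto ht).congr' ?_ EventuallyEq.rfl
    filter_upwards [eventually_gt_atTop 0] with x hx
    simp [← hpow _ x hx]
  refine h1.trans_isLittleO ?_
  have h2 : (fun x : ℝ => (√(x / s))⁻¹ ^ (N + 1)) =o[atTop] fun x : ℝ => (√(x / s))⁻¹ ^ N := by
    have h3 : (fun x : ℝ => (√(x / s))⁻¹) =o[atTop] fun _ : ℝ => (1:ℝ) :=
      (isLittleO_one_iff ℝ).2 (tendsto_inv_atTop_zero.comp ht)
    simpa [pow_succ] using (isBigO_refl (fun x : ℝ => (√(x / s))⁻¹ ^ N) atTop).mul_isLittleO h3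
  refine h2.trans_isBigO (IsBigO.of_bound (s ^ ((N:ℝ) / 2)) ?_)
  filter_upwards [eventually_gt_atTop 0] with x hx
  rw [hpow N x hx, norm_mul, Real.norm_of_nonneg (by positivity : 0 ≤ s ^ ((N:ℝ) / 2))]

theorem product_normal_upper_tail_expansion (μX μY σX σY ρ : ℝ) (n : ℕ) (hn : 1 ≤ n)
    (hσX : 0 < σX) (hσY : 0 < σY) (hρ₁ : -1 < ρ) (hρ₂ : ρ < 1)
    (rX rY s Cn : ℝ) (hrX : rX = μX / σX) (hrY : rY = μY / σY) (hs : s = σX * σY)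
    (hCn : Cn = Real.exp (-((n : ℝ) * (rX ^ 2 + rY ^ 2 - 2 * ρ * rX * rY)) / (2 * (1 - ρ ^ 2))))
    (hsum : rX + rY ≠ 0) (N : ℕ) :
    (fun x : ℝ => (prodLaw μX μY σX σY ρ n (Set.Ioi x)).toReal -
        ((1 + ρ) * Cn / (2 * Real.sqrt (2 * Real.pi)) *
        ((1 + ρ) / (|rX + rY| * Real.sqrt n)) ^ (((n : ℝ) - 1) / 2) *
        Real.exp ((n : ℝ) / 8 * ((1 + ρ) / (1 - ρ)) * (rX - rY) ^ 2) *
        (x / s) ^ (((n : ℝ) - 3) / 4) *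
        Real.exp (|rX + rY| / (1 + ρ) * Real.sqrt ((n : ℝ) * x / s) - x / (s * (1 + ρ)))) *
        ∑ p ∈ Finset.range (N + 1), gammaCoef rX rY ρ n p * s ^ ((p : ℝ) / 2) * x ^ (-(p : ℝ) / 2))
      =o[atTop] fun x : ℝ =>
        ((1 + ρ) * Cn / (2 * Real.sqrt (2 * Real.pi)) *
        ((1 + ρ) / (|rX + rY| * Real.sqrt n)) ^ (((n : ℝ) - 1) / 2) *
        Real.exp ((n : ℝ) / 8 * ((1 + ρ) / (1 - ρ)) * (rX - rY) ^ 2) *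
        (x / s) ^ (((n : ℝ) - 3) / 4) *
        Real.exp (|rX + rY| / (1 + ρ) * Real.sqrt ((n : ℝ) * x / s) - x / (s * (1 + ρ)))) * x ^ (-(N : ℝ) / 2) := by
  have hθ : 0 < 1 + ρ := by linarith
  have hκ : 0 < 1 - ρ := by linarith
  have hn0 : (0:ℝ) < n := by exact_mod_cast hn
  have hR : 0 < |rX + rY| := abs_pos.2 hsum
  have hs0 : 0 < s := hs ▸ mul_pos hσX hσY
  have hb : 0 < |rX + rY| * √n / 2 := by positivity
  have hexp := asympExp_ncGamma_prod_sub_tail hn hθ hb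
    (by positivity : 0 ≤ n * (rX - rY) ^ 2 / (4 * (1 - ρ))) (by positivity : 0 < 1 / (1 - ρ))
  have hK := tail_constant_eq hn hρ₁ hρ₂ hsum
  rw [← hCn] at hK
  set K₀ := (1 + ρ) * Cn / (2 * √(2 * Real.pi)) *
    ((1 + ρ) / (|rX + rY| * √n)) ^ (((n : ℝ) - 1) / 2) *
    Real.exp ((n : ℝ) / 8 * ((1 + ρ) / (1 - ρ)) * (rX - rY) ^ 2) with hK₀
  have hK0 : K₀ ≠ 0 := by
    have : 0 < Cn := hCn ▸ Real.exp_pos _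
    positivity
  have hexp' := ((hexp.congr_coeff (d := fun p => K₀ * gammaCoef rX rY ρ n p) fun p => by
    rw [funext (densityCoef_eq hn hρ₁ hρ₂ hsum), tailCoef_const_mul, tailCoef_eq, ← hK]
    ring).const_mul K₀⁻¹).sub_isLittleO_comp hs0 N
  refine ((isBigO_refl (fun x : ℝ => K₀ * (x / s) ^ (((n : ℝ) - 3) / 4) *
    Real.exp (|rX + rY| / (1 + ρ) * √((n : ℝ) * x / s) - x / (s * (1 + ρ)))) atTop).mul_isLittleO
      hexp').congr' ?_ EventuallyEq.rfl
  filter_upwards [eventually_gt_atTop 0] with x hx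
  have hxs : 0 < x / s := by positivity
  have hL : (|rX + rY| * √n / 2) ^ 2 / (1 + ρ) = n * (rX + rY) ^ 2 / (4 * (1 + ρ)) := by
    rw [div_pow, mul_pow, sq_abs, Real.sq_sqrt hn0.le]
    field_simp
    norm_num
  have hpow : (x / s) ^ (((n : ℝ) - 3) / 4) * √(x / s) ^ (1 - ((n : ℝ) - 1) / 2) = 1 := by
    rw [Real.sqrt_eq_rpow, ← Real.rpow_mul hxs.le, ← Real.rpow_add hxs,
      show ((n : ℝ) - 3) / 4 + 1 / 2 * (1 - ((n : ℝ) - 1) / 2) = 0 by ring, Real.rpow_zero]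
  have hexp1 : Real.exp (|rX + rY| / (1 + ρ) * √((n : ℝ) * x / s) - x / (s * (1 + ρ))) *
      Real.exp (√(x / s) ^ 2 / (1 + ρ) - 2 * (|rX + rY| * √n / 2) / (1 + ρ) * √(x / s)) = 1 := by
    rw [← Real.exp_add, Real.sq_sqrt hxs.le, mul_div_assoc, Real.sqrt_mul hn0.le, div_div]
    ring_nf
    exact Real.exp_zero
  rw [prodLaw_Ioi hσX hσY hρ₁ hρ₂ hn hx, ← hrX, ← hrY, ← hs, ← hL, mul_sub]
  simp only [inv_mul_cancel_left₀ hK0, ← mul_assoc (gammaCoef _ _ _ _ _)]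
  congr 1
  generalize Real.exp (|rX + rY| / (1 + ρ) * √((n : ℝ) * x / s) - x / (s * (1 + ρ))) = E at *
  generalize Real.exp (√(x / s) ^ 2 / (1 + ρ) -
    2 * (|rX + rY| * √n / 2) / (1 + ρ) * √(x / s)) = E' at *
  generalize (x / s) ^ (((n : ℝ) - 3) / 4) = A at *
  generalize √(x / s) ^ (1 - ((n : ℝ) - 1) / 2) = A' at *
  generalize ENNReal.toReal _ = M
  calc _ = K₀ * K₀⁻¹ * (A * A') * (E * E') * M := by ring
    _ = M := by rw [mul_inv_cancel₀ hK0, hpow, hexp1]; ring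

end
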